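/- Let m ≥ 1 be an integer and set w₀(x) := log(2/(1+|x|²)) on ℝ^{2m}. Let K, f : ℝ^{2m} → ℝ be measurable functions with K ≥ 0, K ≢ 0, K e^{−2m w₀} ∈ L^∞(ℝ^{2m}), f e^{−2m w₀} ∈ L^∞(ℝ^{2m}), and Λ := ∫_{ℝ^{2m}} f dx ∈ (0, Λ₁). Then there exist a function w ∈ C^{2m−1}(ℝ^{2m}) and a constant c_w ∈ ℝ such that (−Δ)^m w = K e^{2m(w + c_w)} − f in ℝ^{2m} in the distributional sense, ∫_{ℝ^{2m}} K e^{2m(w + c_w)} dx = Λ, and lim_{|x|→∞} w(x) exists and is finite. -/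

import Mathlib

noncomputable section

open MeasureTheory Real Filter Topology Metric Set Bornology

/-- Euclidean space `ℝ^{2m}`. -/
abbrev Euc (m : ℕ) : Type := EuclideanSpace ℝ (Fin (2*m))

/-- Pointwise Laplacian `Δ f (x) = ∑ ∂²f/∂xᵢ²`. -/
def lap {m : ℕ} (f : Euc m → ℝ) (x : Euc m) : ℝ :=
  ∑ i : Fin (2*m),
    fderiv ℝ (fun y => fderiv ℝ f y (EuclideanSpace.single i (1:ℝ))) x
      (EuclideanSpace.single i (1:ℝ))

/-- `(−Δ)^j f`, pointwise. -/
def negLapPow {m : ℕ} (j : ℕ) (f : Euc m → ℝ) : Euc m → ℝ :=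
  (fun g x => -(lap g x))^[j] f

/-- Smooth test functions compactly supported inside `Ω`. -/
def IsTestOn {m : ℕ} (Ω : Set (Euc m)) (ψ : Euc m → ℝ) : Prop :=
  ContDiff ℝ (⊤ : ℕ∞) ψ ∧ HasCompactSupport ψ ∧ tsupport ψ ⊆ Ω

/-- `u` solves `(−Δ)^m u = V e^{2mu}` on `Ω` in the distributional sense. -/
def SolvesQ {m : ℕ} (Ω : Set (Euc m)) (V u : Euc m → ℝ) : Prop :=
  ∀ ψ : Euc m → ℝ, IsTestOn Ω ψ →
    ∫ x in Ω, u x * negLapPow m ψ x = ∫ x in Ω, V x * Real.exp ((2*m : ℝ) * u x) * ψ x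

/-- Volume of the standard unit `n`-sphere: `2 π^{(n+1)/2} / Γ((n+1)/2)`. -/
def sphereVol (n : ℕ) : ℝ :=
  2 * Real.pi ^ (((n : ℝ) + 1)/2) / Real.Gamma (((n : ℝ) + 1)/2)

/-- `Λ₁ = (2m−1)! vol(S^{2m})`. -/
def Lambda1 (m : ℕ) : ℝ := (Nat.factorial (2*m - 1) : ℝ) * sphereVol (2*m)

/-- `γ_{2m} = Λ₁/2`. -/
def gamma2m (m : ℕ) : ℝ := Lambda1 m / 2

/-- The class `K(Ω,∅)`: smooth, nonpositive, not identically zero, `Δ^m φ ≡ 0` on `Ω`. -/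
def memK {m : ℕ} (Ω : Set (Euc m)) (φ : Euc m → ℝ) : Prop :=
  ContDiffOn ℝ (⊤ : ℕ∞) φ Ω ∧ (∀ x ∈ Ω, φ x ≤ 0) ∧ (∃ x ∈ Ω, φ x ≠ 0) ∧
    ∀ x ∈ Ω, negLapPow m φ x = 0

/-- `S_φ = {x ∈ Ω : φ(x) = 0}`. -/
def Sphi {m : ℕ} (Ω : Set (Euc m)) (φ : Euc m → ℝ) : Set (Euc m) :=
  {x | x ∈ Ω ∧ φ x = 0}

/-- `S_φ^* = S_φ ∪ {x ∈ ∂Ω : lim_{Ω ∋ y → x} φ(y) = 0}`. -/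
def SphiStar {m : ℕ} (Ω : Set (Euc m)) (φ : Euc m → ℝ) : Set (Euc m) :=
  Sphi Ω φ ∪ {x | x ∈ frontier Ω ∧ Tendsto φ (𝓝[Ω] x) (𝓝 0)}

/-- `u_k → +∞` locally uniformly on `S`. -/
def LocUnifTop {m : ℕ} (u : ℕ → Euc m → ℝ) (S : Set (Euc m)) : Prop :=
  ∀ K : Set (Euc m), K ⊆ S → IsCompact K → ∀ C : ℝ,
    ∀ᶠ k in atTop, ∀ x ∈ K, C ≤ u k x

/-- `u_k → −∞` locally uniformly on `S`. -/
def LocUnifBot {m : ℕ} (u : ℕ → Euc m → ℝ) (S : Set (Euc m)) : Prop :=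
  ∀ K : Set (Euc m), K ⊆ S → IsCompact K → ∀ C : ℝ,
    ∀ᶠ k in atTop, ∀ x ∈ K, u k x ≤ C

section

theorem pi_taylor {α : Type} [MeasurableSpace α] {μ : Measure α} {E : Type}
    [NormedAddCommGroup E] [NormedSpace ℝ E] {N : ℕ} (F : α → E → ℝ)
    (hF : ∀ a, ContDiff ℝ N (F a)) (bd : ℕ → α → ℝ)
    (hbd : ∀ j ≤ N, ∀ᵐ a ∂μ, ∀ x, ‖iteratedFDeriv ℝ j (F a) x‖ ≤ bd j a)
    (hinteg : ∀ j ≤ N, Integrable (bd j) μ)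
    (hmeas : ∀ j ≤ N, ∀ x, AEStronglyMeasurable (fun a => iteratedFDeriv ℝ j (F a) x) μ) :
    HasFTaylorSeriesUpTo N (fun x => ∫ a, F a x ∂μ)
      (fun x j => ∫ a, iteratedFDeriv ℝ j (F a) x ∂μ) := by
  refine ⟨?_, ?_, ?_⟩
  · intro x
    have h := (continuousMultilinearCurryFin0 ℝ E ℝ).toContinuousLinearEquiv.integral_comp_comm
      (μ := μ) (fun a => iteratedFDeriv ℝ 0 (F a) x)
    simpa using h.symm
  · intro j hj x
    have hj' : j + 1 ≤ N := by exact_mod_cast hj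
    have key := hasFDerivAt_integral_of_dominated_of_fderiv_le (𝕜 := ℝ) (μ := μ)
      (F := fun x a => iteratedFDeriv ℝ j (F a) x)
      (F' := fun x a => fderiv ℝ (iteratedFDeriv ℝ j (F a)) x) (x₀ := x) (s := univ)
      (bound := bd (j+1)) univ_mem
      (Eventually.of_forall fun y => hmeas j (by omega) y)
      ((hinteg j (by omega)).mono' (hmeas j (by omega) x)
        ((hbd j (by omega)).mono fun a ha => ha x))
      ?_ ?_ (hinteg (j+1) hj') ?_
    · let L : (E [×(j+1)]→L[ℝ] ℝ) ≃L[ℝ] (E →L[ℝ] (E [×j]→L[ℝ] ℝ)) :=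
        (continuousMultilinearCurryLeftEquiv ℝ (fun _ : Fin (j+1) => E) ℝ).toContinuousLinearEquiv
      have h := ContinuousLinearMap.integral_comp_comm (𝕜 := ℝ) (E := E [×(j+1)]→L[ℝ] ℝ)
        (Fₗ := E →L[ℝ] (E [×j]→L[ℝ] ℝ)) (μ := μ) (L : (E [×(j+1)]→L[ℝ] ℝ) →L[ℝ] (E →L[ℝ] (E [×j]→L[ℝ] ℝ)))
        (φ := fun a => iteratedFDeriv ℝ (j+1) (F a) x)
        ((hinteg (j+1) hj').mono' (hmeas (j+1) hj' x) ((hbd (j+1) hj').mono fun a ha => ha x))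
      exact key.congr_fderiv h
    · have h := (continuousMultilinearCurryLeftEquiv ℝ (fun _ : Fin (j+1) => E)
        ℝ).toContinuousLinearEquiv.continuous.comp_aestronglyMeasurable (hmeas (j+1) hj' x)
      exact h
    · filter_upwards [hbd (j+1) hj'] with a ha y _
      rw [norm_fderiv_iteratedFDeriv]
      exact ha y
    · refine Eventually.of_forall fun a y _ => ?_
      exact ((hF a).differentiable_iteratedFDeriv (by exact_mod_cast hj) y).hasFDerivAt
  · intro j hj
    have hj' : j ≤ N := by exact_mod_cast hj
    refine continuous_of_dominated (hmeas j hj') (fun x => (hbd j hj').mono fun a ha => ha x)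
      (hinteg j hj') (Eventually.of_forall fun a => (hF a).continuous_iteratedFDeriv (by exact_mod_cast hj'))

/-- Gaussian. -/
def gs {m : ℕ} (x : Euc m) : ℝ := Real.exp (-‖x‖^2)

/-- weight -/
def bw {m : ℕ} (x : Euc m) : ℝ := (1 + ‖x‖) ^ (-(4 * m : ℝ))

/-- class of functions bounded by the weight -/
structure Cls {m : ℕ} (C : ℝ) (g : Euc m → ℝ) : Prop where
  meas : Measurable g
  bd : ∀ x, |g x| ≤ C * bw x

variable {m : ℕ}

lemma bw_pos (x : Euc m) : 0 < bw x := by unfold bw; positivity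
lemma bw_le_one (x : Euc m) : bw x ≤ 1 := by
  unfold bw
  apply Real.rpow_le_one_of_one_le_of_nonpos
  · linarith [norm_nonneg x]
  · have : (0:ℝ) ≤ m := by positivity
    linarith
lemma bw_cont : Continuous (bw : Euc m → ℝ) := by
  unfold bw
  refine Continuous.rpow_const (by fun_prop) (fun x => Or.inl (by positivity))
lemma bw_int (hm : 1 ≤ m) : Integrable (bw : Euc m → ℝ) := by
  unfold bw
  apply integrable_one_add_norm
  have : (1:ℝ) ≤ m := by exact_mod_cast hm
  simp; linarith

lemma Cls.integrable {C : ℝ} {g : Euc m → ℝ} (hm : 1 ≤ m) (h : Cls C g) : Integrable g :=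
  ((bw_int hm).const_mul C).mono' h.meas.aestronglyMeasurable (Eventually.of_forall h.bd)

lemma Cls.nonneg {C : ℝ} {g : Euc m → ℝ} (h : Cls C g) : 0 ≤ C := by
  have := (abs_nonneg _).trans (h.bd 0)
  by_contra hc
  nlinarith [bw_pos (0 : Euc m)]

lemma gs_contDiff : ContDiff ℝ ⊤ (gs : Euc m → ℝ) := by
  unfold gs
  exact Real.contDiff_exp.comp (contDiff_norm_sq ℝ).neg

/-- the bilinear form `-2⟨x,y⟩`. -/
def ipB (m : ℕ) : Euc m →L[ℝ] Euc m →L[ℝ] ℝ :=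
  LinearMap.mkContinuous₂ (LinearMap.mk₂ ℝ (fun x y : Euc m => -2 * inner ℝ x y)
    (by intros; simp [inner_add_left]; ring) (by intros; simp [inner_smul_left]; ring)
    (by intros; simp [inner_add_right]; ring) (by intros; simp [inner_smul_right]; ring)) 2
    (by
      intro x y
      simp only [LinearMap.mk₂_apply, norm_mul]
      have := norm_inner_le_norm (𝕜 := ℝ) x y
      norm_num at this ⊢
      linarith)

lemma ipB_norm : ‖ipB m‖ ≤ 2 := LinearMap.mkContinuous₂_norm_le _ (by norm_num) _

lemma iter_normsq (i : ℕ) (hi : 1 ≤ i) (x : Euc m) :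
    ‖iteratedFDeriv ℝ i (fun x : Euc m => -‖x‖^2) x‖ ≤ (2 * (1 + ‖x‖)) ^ i := by
  obtain ⟨k, rfl⟩ : ∃ k, i = k + 1 := ⟨i - 1, by omega⟩
  rw [← norm_iteratedFDeriv_fderiv]
  have h1 : fderiv ℝ (fun x : Euc m => -‖x‖^2) = fun x => ipB m x := by
    ext x y
    have h2 := ((hasStrictFDerivAt_norm_sq x).hasFDerivAt.neg).fderiv
    have h3 : fderiv ℝ (fun x : Euc m => -‖x‖^2) x = fderiv ℝ (-fun x : Euc m => ‖x‖^2) x := rfl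
    rw [h3, h2]; simp [ipB]
  rw [h1]
  have h0 := norm_nonneg x
  rcases k with _ | k
  · rw [norm_iteratedFDeriv_zero]
    have := (ipB m).le_of_opNorm_le ipB_norm x
    simp; linarith
  · rw [← norm_iteratedFDeriv_fderiv]
    have h2 : fderiv ℝ (fun x : Euc m => ipB m x) = fun _ => ipB m := by
      ext1 x
      exact ContinuousLinearMap.fderiv _
    rw [h2]
    rcases k with _ | k
    · rw [norm_iteratedFDeriv_zero]
      refine ipB_norm.trans ?_
      norm_num
      nlinarith
    · rw [iteratedFDeriv_const_of_ne (by omega)]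
      simp; positivity

lemma gs_deriv_aux (j : ℕ) (x : Euc m) :
    ‖iteratedFDeriv ℝ j (gs : Euc m → ℝ) x‖ ≤ j.factorial * Real.exp (-‖x‖^2) * (2 * (1 + ‖x‖))^j := by
  have : (gs : Euc m → ℝ) = Real.exp ∘ (fun x : Euc m => -‖x‖^2) := rfl
  rw [this]
  refine norm_iteratedFDeriv_comp_le (N := ⊤) (Real.contDiff_exp) ((contDiff_norm_sq ℝ).neg) le_top x ?_ ?_
  · intro i _
    rw [norm_iteratedFDeriv_eq_norm_iteratedDeriv, iteratedDeriv_eq_iterate, Real.iter_deriv_exp]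
    simp
  · intro i hi _
    exact iter_normsq i hi x

lemma gs_deriv (m j : ℕ) : ∃ A : ℝ, 0 ≤ A ∧ ∀ x : Euc m,
    ‖iteratedFDeriv ℝ j (gs : Euc m → ℝ) x‖ ≤ A * bw x := by
  refine ⟨j.factorial * 2^j * ((j + 4*m).factorial * Real.exp (5/4)), by positivity, fun x => ?_⟩
  refine (gs_deriv_aux j x).trans ?_
  have h1 := Real.pow_div_factorial_le_exp (1+‖x‖) (by positivity) (j+4*m)
  rw [div_le_iff₀ (by positivity)] at h1
  have h2 : bw x = ((1+‖x‖)^(4*m))⁻¹ := by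
    unfold bw
    rw [Real.rpow_neg (by positivity)]
    congr 1
    exact_mod_cast Real.rpow_natCast _ (4*m)
  rw [h2, ← div_eq_mul_inv, le_div_iff₀ (by positivity)]
  have h3 : Real.exp (1+‖x‖) * Real.exp (-‖x‖^2) ≤ Real.exp (5/4) := by
    rw [← Real.exp_add]
    apply Real.exp_le_exp.2
    nlinarith [sq_nonneg (‖x‖-1/2)]
  calc _ = (j.factorial * 2^j) * ((1+‖x‖)^(j+4*m) * Real.exp (-‖x‖^2)) := by
        rw [mul_pow, pow_add]; ring
    _ ≤ (j.factorial * 2^j) * ((Real.exp (1+‖x‖) * (j + 4*m).factorial) * Real.exp (-‖x‖^2)) := by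
        gcongr
    _ = (j.factorial * 2^j) * ((j + 4*m).factorial * (Real.exp (1+‖x‖) * Real.exp (-‖x‖^2))) := by ring
    _ ≤ _ := by gcongr

end

section

variable {m : ℕ}

/-- Gaussian average at scale `1/s`. -/
def hh (g : Euc m → ℝ) (s : ℝ) (x : Euc m) : ℝ := ∫ y, gs (s • (x - y)) * g y

/-- heat potential -/
def VV (g : Euc m → ℝ) (x : Euc m) : ℝ := ∫ s in Ioi (0:ℝ), hh g s x / s

lemma gs_cont : Continuous (gs : Euc m → ℝ) := gs_contDiff.continuous

lemma iter_gs (j : ℕ) (s c : ℝ) (y x : Euc m) :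
    iteratedFDeriv ℝ j (fun x : Euc m => gs (s • (x - y)) * c) x
      = (c * s^j) • iteratedFDeriv ℝ j (gs : Euc m → ℝ) (s • (x - y)) := by
  have hc : ∀ n : ℕ, ContDiff ℝ n (gs : Euc m → ℝ) := fun n => gs_contDiff.of_le le_top
  have h1 : ContDiff ℝ j (fun x : Euc m => gs (s • (x - y))) :=
    (hc j).comp (by fun_prop)
  have h0 : (fun x : Euc m => gs (s • (x - y)) * c) = c • (fun x : Euc m => gs (s • (x - y))) := by
    ext x; simp [mul_comm]
  rw [h0, iteratedFDeriv_const_smul_apply h1.contDiffAt]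
  have h2 := iteratedFDeriv_comp_sub (𝕜 := ℝ) (f := fun z : Euc m => gs (s • z)) j y x
  rw [h2, iteratedFDeriv_comp_const_smul s (hc j), smul_smul]

lemma iter_gs_meas {g : Euc m → ℝ} (hg : Measurable g) (j : ℕ) (x : Euc m) :
    StronglyMeasurable (fun p : ℝ × Euc m =>
      (g p.2 * p.1^j) • iteratedFDeriv ℝ j (gs : Euc m → ℝ) (p.1 • (x - p.2))) := by
  have h1 : Measurable (fun p : ℝ × Euc m => g p.2 * p.1^j) := by fun_prop
  have h2 : Continuous (fun p : ℝ × Euc m => iteratedFDeriv ℝ j (gs : Euc m → ℝ) (p.1 • (x - p.2))) :=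
    (gs_contDiff.continuous_iteratedFDeriv (m := j) le_top).comp (by fun_prop)
  exact h1.stronglyMeasurable.smul h2.stronglyMeasurable

lemma hh_taylor (hm : 1 ≤ m) {C : ℝ} {g : Euc m → ℝ} (h : Cls C g) (s : ℝ) (N : ℕ) :
    HasFTaylorSeriesUpTo N (hh g s) (fun x j => ∫ y, iteratedFDeriv ℝ j
      (fun x : Euc m => gs (s • (x - y)) * g y) x) := by
  choose A hA0 hA using fun j => gs_deriv m j
  refine pi_taylor (fun y x => gs (s • (x - y)) * g y) ?_ (fun j y => |g y| * |s|^j * A j) ?_ ?_ ?_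
  · intro y
    have : ContDiff ℝ N (fun x : Euc m => gs (s • (x - y))) :=
      (gs_contDiff.of_le le_top).comp (by fun_prop)
    exact this.mul contDiff_const
  · intro j _
    refine Eventually.of_forall fun y x => ?_
    rw [iter_gs, norm_smul, norm_mul, norm_pow, Real.norm_eq_abs, Real.norm_eq_abs]
    gcongr
    refine (hA j _).trans ?_
    nlinarith [hA0 j, bw_le_one (s • (x - y))]
  · intro j _
    exact ((h.integrable hm).abs.mul_const _).mul_const _
  · intro j _ x
    simp_rw [iter_gs]
    exact ((iter_gs_meas h.meas j x).comp_measurable (measurable_prodMk_left (x := s))).aestronglyMeasurable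

lemma hh_contDiff (hm : 1 ≤ m) {C : ℝ} {g : Euc m → ℝ} (h : Cls C g) (s : ℝ) (N : ℕ) :
    ContDiff ℝ N (hh g s) := (hh_taylor hm h s N).contDiff

lemma hh_iter (hm : 1 ≤ m) {C : ℝ} {g : Euc m → ℝ} (h : Cls C g) (s : ℝ) (j : ℕ) (x : Euc m) :
    iteratedFDeriv ℝ j (hh g s) x =
      ∫ y, (g y * s^j) • iteratedFDeriv ℝ j (gs : Euc m → ℝ) (s • (x - y)) := by
  have := (hh_taylor hm h s j).eq_iteratedFDeriv (m := j) le_rfl x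
  simp_rw [iter_gs] at this
  exact this.symm

lemma bw_scale (s : ℝ) (hs : 0 < s) (x : Euc m) :
    ∫ y, bw (s • (x - y)) = (s^(2*m))⁻¹ * ∫ y : Euc m, bw y := by
  rw [integral_sub_left_eq_self (fun y => bw (s • y)) volume x, Measure.integral_comp_smul]
  simp [abs_of_pos hs]

lemma bw_scale_int (hm : 1 ≤ m) (s : ℝ) (hs : 0 < s) (x : Euc m) :
    Integrable (fun y => bw (s • (x - y))) := by
  have h1 : Integrable (fun y : Euc m => bw (s • y)) := (bw_int hm).comp_smul hs.ne'
  exact h1.comp_sub_left x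

lemma hh_bound (hm : 1 ≤ m) (j : ℕ) : ∃ A : ℝ, 0 ≤ A ∧ ∀ (C : ℝ) (g : Euc m → ℝ), Cls C g →
    ∀ s : ℝ, 0 < s → ∀ x, ‖iteratedFDeriv ℝ j (hh g s) x‖ ≤ C * A * s^j ∧
      ‖iteratedFDeriv ℝ j (hh g s) x‖ ≤ C * A * s^j * (s^(2*m))⁻¹ := by
  obtain ⟨A, hA0, hA⟩ := gs_deriv m j
  have hI : 0 ≤ ∫ y : Euc m, bw y := integral_nonneg fun y => (bw_pos y).le
  refine ⟨A * ∫ y : Euc m, bw y, by positivity, fun C g h s hs x => ?_⟩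
  have hC := h.nonneg
  rw [hh_iter hm h]
  have hp : ∀ y, ‖(g y * s^j) • iteratedFDeriv ℝ j (gs : Euc m → ℝ) (s • (x - y))‖
      ≤ (C * bw y * s^j) * (A * bw (s • (x - y))) := by
    intro y
    rw [norm_smul, norm_mul, norm_pow, Real.norm_eq_abs, Real.norm_eq_abs, abs_of_pos hs]
    have := bw_pos y
    gcongr
    · exact h.bd y
    · exact hA _
  constructor
  · calc _ ≤ ∫ y : Euc m, (C * A * s^j) * bw y := by
          refine norm_integral_le_of_norm_le ((bw_int hm).const_mul _) (Eventually.of_forall fun y => ?_)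
          refine (hp y).trans ?_
          have := bw_le_one (s • (x - y))
          have h2 := bw_pos y
          calc _ ≤ (C * bw y * s^j) * (A * 1) := by gcongr
            _ = _ := by ring
      _ = _ := by rw [integral_const_mul]; ring
  · calc _ ≤ ∫ y : Euc m, (C * A * s^j) * bw (s • (x - y)) := by
          refine norm_integral_le_of_norm_le ((bw_scale_int hm s hs x).const_mul _) (Eventually.of_forall fun y => ?_)
          refine (hp y).trans ?_
          have := bw_le_one y
          have h2 := bw_pos (s • (x - y))
          calc _ ≤ (C * 1 * s^j) * (A * bw (s • (x - y))) := by gcongr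
            _ = _ := by ring
      _ = _ := by rw [integral_const_mul, bw_scale s hs]; ring

lemma gs_lip (m : ℕ) : ∃ A : ℝ, 0 ≤ A ∧ ∀ x y : Euc m, |gs x - gs y| ≤ A * ‖x - y‖ := by
  obtain ⟨A, hA0, hA⟩ := gs_deriv m 1
  refine ⟨A, hA0, fun x y => ?_⟩
  refine (convex_univ).norm_image_sub_le_of_norm_fderiv_le (𝕜 := ℝ) (f := gs) (C := A) ?_ ?_ (mem_univ y) (mem_univ x)
  · intro z _
    exact gs_contDiff.differentiable (by simp) z
  · intro z _
    rw [← norm_iteratedFDeriv_one]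
    refine (hA z).trans ?_
    nlinarith [bw_le_one z]

lemma bw_norm_int (hm : 1 ≤ m) : Integrable (fun y : Euc m => ‖y‖ * bw y) := by
  have h1 : Integrable (fun y : Euc m => (1 + ‖y‖) ^ (-(4 * m - 1 : ℝ))) := by
    apply integrable_one_add_norm
    have : (1:ℝ) ≤ m := by exact_mod_cast hm
    simp; linarith
  refine h1.mono' (by have := bw_cont (m := m); fun_prop) (Eventually.of_forall fun y => ?_)
  have hb := bw_pos y
  rw [Real.norm_of_nonneg (by positivity)]
  have h3 : (1 + ‖y‖) ^ (-(4 * m - 1 : ℝ)) = (1 + ‖y‖) * bw y := by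
    unfold bw
    rw [show (-(4 * m - 1 : ℝ)) = 1 + (-(4*m)) by ring, Real.rpow_add (by positivity), Real.rpow_one]
  rw [h3]
  nlinarith

lemma hh_mean (hm : 1 ≤ m) : ∃ A : ℝ, 0 ≤ A ∧ ∀ (C : ℝ) (g : Euc m → ℝ), Cls C g → ∫ y, g y = 0 →
    ∀ s : ℝ, 0 < s → ∀ x, |hh g s x| ≤ C * A * s := by
  obtain ⟨A, hA0, hA⟩ := gs_lip m
  have hI : 0 ≤ ∫ y : Euc m, ‖y‖ * bw y :=
    integral_nonneg fun y => mul_nonneg (norm_nonneg _) (bw_pos y).le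
  refine ⟨A * ∫ y : Euc m, ‖y‖ * bw y, by positivity, fun C g h h0 s hs x => ?_⟩
  have hi := h.integrable hm
  have hgi : Integrable (fun y => gs (s • (x - y)) * g y) := by
    refine hi.norm.mono' ?_ (Eventually.of_forall fun y => ?_)
    · have := (gs_cont (m := m)).measurable
      exact ((this.comp (by fun_prop)).mul h.meas).aestronglyMeasurable
    · rw [norm_mul]
      have : ‖gs (s • (x - y))‖ ≤ 1 := by
        unfold gs
        rw [Real.norm_of_nonneg (by positivity)]
        exact Real.exp_le_one_iff.2 (by simp)
      nlinarith [norm_nonneg (g y)]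
  have e : hh g s x = ∫ y, (gs (s • (x - y)) - gs (s • x)) * g y := by
    unfold hh
    simp_rw [sub_mul]
    rw [integral_sub hgi (hi.const_mul _), integral_const_mul, h0]
    simp
  rw [e, ← Real.norm_eq_abs]
  calc _ ≤ ∫ y : Euc m, (C * A * s) * (‖y‖ * bw y) := by
        refine norm_integral_le_of_norm_le ((bw_norm_int hm).const_mul _) (Eventually.of_forall fun y => ?_)
        rw [norm_mul]
        have h1 := hA (s • (x - y)) (s • x)
        rw [← smul_sub, norm_smul, Real.norm_of_nonneg hs.le] at h1
        simp only [sub_sub_cancel_left, norm_neg] at h1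
        calc _ ≤ (A * (s * ‖y‖)) * (C * bw y) := by
              gcongr
              · exact h1
              · exact h.bd y
          _ = _ := by ring
    _ = _ := by rw [integral_const_mul]; ring

/-- main decay bound in `s` -/
lemma hh_beta (hm : 1 ≤ m) : ∃ A : ℝ, 0 ≤ A ∧ ∀ (C : ℝ) (g : Euc m → ℝ), Cls C g → ∫ y, g y = 0 →
    ∀ j ≤ 2*m-1, ∀ s : ℝ, 0 < s → ∀ x, ‖iteratedFDeriv ℝ j (hh g s) x‖ / s ≤ C * A * (1+s^2)⁻¹ := by
  choose A hA0 hA using fun j => hh_bound hm j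
  obtain ⟨B, hB0, hB⟩ := hh_mean hm
  refine ⟨2 * (B + ∑ i ∈ Finset.range (2*m), A i),
    mul_nonneg (by norm_num) (add_nonneg hB0 (Finset.sum_nonneg fun i _ => hA0 i)),
    fun C g h h0 j hj s hs x => ?_⟩
  have hC := h.nonneg
  have hAs : A j ≤ ∑ i ∈ Finset.range (2*m), A i :=
    Finset.single_le_sum (f := A) (fun i _ => hA0 i) (Finset.mem_range.2 (by omega))
  obtain ⟨b1, b2⟩ := hA j C g h s hs x
  set S := ∑ i ∈ Finset.range (2*m), A i
  have hS : 0 ≤ S := (hA0 j).trans hAs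
  have hAj := hA0 j
  rw [div_le_iff₀ hs]
  rcases le_or_gt s 1 with h1 | h1
  · have hinv : 1 ≤ 2 * (1+s^2)⁻¹ := by
      rw [← div_eq_mul_inv, le_div_iff₀ (by positivity)]
      nlinarith
    have key : ‖iteratedFDeriv ℝ j (hh g s) x‖ ≤ C * (B + S) * s := by
      rcases Nat.eq_zero_or_pos j with rfl | hjp
      · rw [norm_iteratedFDeriv_zero, Real.norm_eq_abs]
        refine (hB C g h h0 s hs x).trans ?_
        gcongr; linarith
      · refine b1.trans ?_
        have : s^j ≤ s := by
          have := pow_le_pow_of_le_one hs.le h1 (show 1 ≤ j from hjp)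
          simpa using this
        have : A j ≤ B + S := by linarith
        gcongr
    calc _ ≤ C * (B + S) * s := key
      _ = C * (B + S) * s * 1 := by ring
      _ ≤ C * (B + S) * s * (2 * (1+s^2)⁻¹) := by gcongr
      _ = _ := by ring
  · have hinv : (s^2)⁻¹ ≤ 2 * (1+s^2)⁻¹ := by
      rw [← div_eq_mul_inv, le_div_iff₀ (by positivity), inv_mul_le_iff₀ (by positivity)]
      nlinarith
    have hpw : s^j * (s^(2*m))⁻¹ ≤ (s^2)⁻¹ * s := by
      have e1 : s^(2*m) = s^(2*m-1) * s := by rw [← pow_succ]; congr 1; omega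
      have e2 : s^j ≤ s^(2*m-1) := pow_le_pow_right₀ h1.le hj
      have e3 : (s^2)⁻¹ * s = s⁻¹ := by field_simp
      rw [e3, e1, mul_inv]
      have : 0 < s^(2*m-1) := by positivity
      calc _ ≤ s^(2*m-1) * ((s^(2*m-1))⁻¹ * s⁻¹) := by gcongr
        _ = _ := by field_simp
    calc _ ≤ C * A j * s^j * (s^(2*m))⁻¹ := b2
      _ = C * A j * (s^j * (s^(2*m))⁻¹) := by ring
      _ ≤ C * (B + S) * ((s^2)⁻¹ * s) := by
          have : A j ≤ B + S := by linarith
          gcongr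
      _ ≤ C * (B + S) * (2 * (1+s^2)⁻¹ * s) := by gcongr
      _ = _ := by ring

end

section

variable {m : ℕ}

lemma hh_meas2 {g : Euc m → ℝ} (hg : Measurable g) :
    StronglyMeasurable (fun p : ℝ × Euc m => hh g p.1 p.2) := by
  unfold hh
  have h : StronglyMeasurable (fun q : (ℝ × Euc m) × Euc m => gs (q.1.1 • (q.1.2 - q.2)) * g q.2) := by
    have h1 := (gs_cont (m := m)).measurable
    have h2 : Measurable (fun q : (ℝ × Euc m) × Euc m => gs (q.1.1 • (q.1.2 - q.2))) :=
      h1.comp (by fun_prop)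
    exact (h2.mul (hg.comp measurable_snd)).stronglyMeasurable
  exact h.integral_prod_right

lemma hh_iter_div (hm : 1 ≤ m) {C : ℝ} {g : Euc m → ℝ} (h : Cls C g) (s : ℝ) (j : ℕ) (x : Euc m) :
    iteratedFDeriv ℝ j (fun x => hh g s x / s) x = s⁻¹ • iteratedFDeriv ℝ j (hh g s) x := by
  have h0 : (fun x => hh g s x / s) = s⁻¹ • (hh g s) := by
    ext x; simp [div_eq_inv_mul]
  rw [h0, iteratedFDeriv_const_smul_apply (hh_contDiff hm h s j).contDiffAt]

lemma beta_int (c : ℝ) : Integrable (fun s : ℝ => c * (1+s^2)⁻¹) (volume.restrict (Ioi 0)) :=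
  (integrable_inv_one_add_sq.const_mul c).restrict

lemma VV_taylor (hm : 1 ≤ m) : ∃ A : ℝ, 0 ≤ A ∧ ∀ (C : ℝ) (g : Euc m → ℝ), Cls C g → ∫ y, g y = 0 →
    HasFTaylorSeriesUpTo (2*m-1 : ℕ) (VV g) (fun x j => ∫ s in Ioi (0:ℝ), iteratedFDeriv ℝ j
      (fun x : Euc m => hh g s x / s) x) ∧
    (∀ j ≤ 2*m-1, ∀ x, ‖iteratedFDeriv ℝ j (VV g) x‖ ≤ C * A) ∧
    ∀ s : ℝ, 0 < s → ∀ x, |hh g s x / s| ≤ C * A * (1+s^2)⁻¹ := by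
  obtain ⟨A, hA0, hA⟩ := hh_beta hm
  have hI : 0 ≤ ∫ s in Ioi (0:ℝ), (1+s^2)⁻¹ := integral_nonneg fun s => by positivity
  refine ⟨A * (1 + ∫ s in Ioi (0:ℝ), (1+s^2)⁻¹), by positivity, fun C g h h0 => ?_⟩
  have hC := h.nonneg
  have hbd : ∀ j ≤ 2*m-1, ∀ s : ℝ, 0 < s → ∀ x, ‖iteratedFDeriv ℝ j (fun x => hh g s x / s) x‖
      ≤ C * A * (1+s^2)⁻¹ := by
    intro j hj s hs x
    rw [hh_iter_div hm h, norm_smul, norm_inv, Real.norm_of_nonneg hs.le, ← div_eq_inv_mul]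
    exact hA C g h h0 j hj s hs x
  have hbd' : ∀ j ≤ 2*m-1, ∀ᵐ s ∂(volume.restrict (Ioi (0:ℝ))), ∀ x,
      ‖iteratedFDeriv ℝ j (fun x => hh g s x / s) x‖ ≤ C * A * (1+s^2)⁻¹ := fun j hj =>
    (ae_restrict_mem measurableSet_Ioi).mono fun s hs => hbd j hj s hs
  have hT : HasFTaylorSeriesUpTo (2*m-1 : ℕ) (VV g) (fun x j => ∫ s in Ioi (0:ℝ),
      iteratedFDeriv ℝ j (fun x : Euc m => hh g s x / s) x) := by
    refine pi_taylor (fun s x => hh g s x / s) (fun s => (hh_contDiff hm h s _).div_const s)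
      (fun _ s => C * A * (1+s^2)⁻¹) hbd' (fun j _ => beta_int _) ?_
    intro j _ x
    simp_rw [hh_iter_div hm h, hh_iter hm h]
    have h1 : StronglyMeasurable (fun s : ℝ => ∫ y, (g y * s^j) •
        iteratedFDeriv ℝ j (gs : Euc m → ℝ) (s • (x - y))) :=
      (iter_gs_meas h.meas j x).integral_prod_right'
    have h2 : Measurable (fun s : ℝ => s⁻¹) := measurable_inv
    exact (h2.stronglyMeasurable.smul h1).aestronglyMeasurable
  refine ⟨hT, ?_, ?_⟩
  · intro j hj x
    rw [← hT.eq_iteratedFDeriv (m := j) (by exact_mod_cast hj) x]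
    calc _ ≤ ∫ s in Ioi (0:ℝ), C * A * (1+s^2)⁻¹ :=
          norm_integral_le_of_norm_le (beta_int _) ((hbd' j hj).mono fun s hs => hs x)
      _ = C * A * ∫ s in Ioi (0:ℝ), (1+s^2)⁻¹ := by rw [integral_const_mul]
      _ ≤ _ := by rw [mul_assoc]; gcongr; linarith
  · intro s hs x
    have := hbd 0 (by omega) s hs x
    rw [norm_iteratedFDeriv_zero, Real.norm_eq_abs] at this
    refine this.trans ?_
    gcongr
    nlinarith

lemma VV_contDiff (hm : 1 ≤ m) {C : ℝ} {g : Euc m → ℝ} (h : Cls C g) (h0 : ∫ y, g y = 0) :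
    ContDiff ℝ (2*m-1 : ℕ) (VV g) := by
  obtain ⟨A, _, hA⟩ := VV_taylor hm
  exact (hA C g h h0).1.contDiff

lemma VV_lip (hm : 1 ≤ m) : ∃ A : ℝ, 0 ≤ A ∧ ∀ (C : ℝ) (g : Euc m → ℝ), Cls C g → ∫ y, g y = 0 →
    ∀ x y, |VV g x - VV g y| ≤ C * A * ‖x - y‖ := by
  obtain ⟨A, hA0, hA⟩ := VV_taylor hm
  refine ⟨A, hA0, fun C g h h0 x y => ?_⟩
  obtain ⟨h1, h2, _⟩ := hA C g h h0
  refine (convex_univ).norm_image_sub_le_of_norm_fderiv_le (𝕜 := ℝ) (f := VV g) (C := C * A) ?_ ?_ (mem_univ y) (mem_univ x)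
  · intro z _
    refine h1.contDiff.differentiable ?_ z
    norm_cast; omega
  · intro z _
    rw [← norm_iteratedFDeriv_one]
    exact h2 1 (by omega) z

lemma gs_le_one (x : Euc m) : gs x ≤ 1 := Real.exp_le_one_iff.2 (by simp)
lemma gs_pos (x : Euc m) : 0 < gs x := Real.exp_pos _

lemma VV_lim (hm : 1 ≤ m) {C : ℝ} {g : Euc m → ℝ} (h : Cls C g) (h0 : ∫ y, g y = 0) :
    Tendsto (VV g) (cocompact (Euc m)) (𝓝 0) := by
  obtain ⟨A, _, hA⟩ := VV_taylor hm
  obtain ⟨_, _, h3⟩ := hA C g h h0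
  have hcg : (cocompact (Euc m)).IsCountablyGenerated := by
    rw [← Metric.cobounded_eq_cocompact, ← comap_norm_atTop]; infer_instance
  have : Tendsto (VV g) (cocompact (Euc m)) (𝓝 (∫ s in Ioi (0:ℝ), (0:ℝ))) := by
    refine tendsto_integral_filter_of_dominated_convergence (fun s => C * A * (1+s^2)⁻¹) ?_ ?_ (beta_int _) ?_
    · refine Eventually.of_forall fun x => ?_
      have h1 : Measurable (fun s : ℝ => hh g s x) :=
        ((hh_meas2 h.meas).comp_measurable (measurable_prodMk_right (y := x))).measurable
      exact (h1.div measurable_id).aestronglyMeasurable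
    · refine Eventually.of_forall fun x => ?_
      filter_upwards [ae_restrict_mem measurableSet_Ioi] with s hs
      exact h3 s hs x
    · filter_upwards [ae_restrict_mem measurableSet_Ioi] with s hs
      have hs : 0 < s := hs
      have h4 : Tendsto (fun x => hh g s x) (cocompact (Euc m)) (𝓝 (∫ y : Euc m, (0:ℝ))) := by
        refine tendsto_integral_filter_of_dominated_convergence (fun y => |g y|) ?_ ?_ (h.integrable hm).abs ?_
        · refine Eventually.of_forall fun x => ?_
          have := (gs_cont (m := m)).measurable
          exact ((this.comp (by fun_prop)).mul h.meas).aestronglyMeasurable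
        · refine Eventually.of_forall fun x => Eventually.of_forall fun y => ?_
          rw [norm_mul, Real.norm_of_nonneg (gs_pos _).le, Real.norm_eq_abs]
          nlinarith [abs_nonneg (g y), gs_le_one (s • (x - y))]
        · refine Eventually.of_forall fun y => ?_
          have h5 : Tendsto (fun x : Euc m => ‖s • (x - y)‖) (cocompact (Euc m)) atTop := by
            simp_rw [norm_smul, Real.norm_of_nonneg hs.le]
            refine Tendsto.const_mul_atTop hs ?_
            have : Tendsto (fun x : Euc m => ‖x‖ - ‖y‖) (cocompact (Euc m)) atTop :=
              tendsto_atTop_add_const_right _ _ (tendsto_norm_cocompact_atTop (E := Euc m))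
            exact tendsto_atTop_mono (fun x => norm_sub_norm_le x y) this
          have h6 : Tendsto (fun x : Euc m => gs (s • (x - y))) (cocompact (Euc m)) (𝓝 0) := by
            unfold gs
            refine Real.tendsto_exp_atBot.comp ?_
            refine tendsto_neg_atTop_atBot.comp ?_
            exact (tendsto_pow_atTop (by norm_num)).comp h5
          simpa using h6.mul_const (g y)
      simpa using h4.div_const s
  simpa using this

lemma gs_scale_int (hm : 1 ≤ m) (s : ℝ) (hs : 0 < s) (x : Euc m) :
    Integrable (fun y => gs (s • (x - y))) := by
  obtain ⟨A, hA0, hA⟩ := gs_deriv m 0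
  have hg : Integrable (gs : Euc m → ℝ) :=
    ((bw_int hm).const_mul A).mono' gs_cont.aestronglyMeasurable
      (Eventually.of_forall fun x => by simpa using hA x)
  have h1 : Integrable (fun y : Euc m => gs (s • y)) := hg.comp_smul hs.ne'
  exact h1.comp_sub_left x

lemma gs_even (x : Euc m) : gs (-x) = gs x := by simp [gs]

lemma gs_semigroup (s : ℝ) (x y : Euc m) :
    ∫ z, gs ((√2 * s) • (x - z)) * gs ((√2 * s) • (y - z))
      = gs (s • (x - y)) * ∫ z : Euc m, gs ((2*s) • z) := by
  have h : ∀ z, gs ((√2 * s) • (x - z)) * gs ((√2 * s) • (y - z))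
      = gs (s • (x - y)) * gs ((2*s) • ((2:ℝ)⁻¹ • (x + y) - z)) := by
    intro z
    unfold gs
    rw [← Real.exp_add, ← Real.exp_add]
    congr 1
    have p := parallelogram_law_with_norm ℝ (x - z) (y - z)
    have e1 : x - z + (y - z) = (2:ℝ) • ((2:ℝ)⁻¹ • (x + y) - z) := by
      rw [smul_sub, smul_smul]; norm_num; rw [two_smul]; abel
    have e2 : x - z - (y - z) = x - y := by abel
    rw [e1, e2, norm_smul] at p
    simp only [norm_smul, mul_pow, Real.norm_eq_abs, sq_abs]
    rw [Real.sq_sqrt (by norm_num)]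
    rw [Real.norm_of_nonneg (by norm_num : (0:ℝ) ≤ 2)] at p
    linear_combination s^2 * p
  simp_rw [h]
  rw [integral_const_mul, integral_sub_left_eq_self (fun z => gs ((2*s) • z)) volume]

lemma hh_pos (hm : 1 ≤ m) {C : ℝ} {g : Euc m → ℝ} (h : Cls C g) (s : ℝ) (hs : 0 < s) :
    0 ≤ ∫ x, g x * hh g s x := by
  set κ := ∫ z : Euc m, gs ((2*s) • z) with hκ
  have hκpos : 0 < κ := by
    refine integral_pos_of_integrable_nonneg_nonzero (x := 0) (by have := gs_cont (m := m); fun_prop) ?_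
      (fun z => (gs_pos _).le) (gs_pos _).ne'
    have := gs_scale_int hm (2*s) (by positivity) 0
    simpa [gs_even] using this
  set σ := √2 * s with hσ
  have hσp : 0 < σ := by positivity
  have hi := h.integrable hm
  have gm := (gs_cont (m := m)).measurable
  have e1 : ∀ x, κ * hh g s x = ∫ z, gs (σ • (x - z)) * hh g σ z := by
    intro x
    calc κ * hh g s x = ∫ y, ∫ z, gs (σ • (x - z)) * gs (σ • (y - z)) * g y := by
          unfold hh
          rw [← integral_const_mul]
          congr 1; ext y
          rw [integral_mul_const, gs_semigroup]; ring
      _ = ∫ z, ∫ y, gs (σ • (x - z)) * gs (σ • (y - z)) * g y := by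
          refine integral_integral_swap ?_
          have hd : Integrable (fun p : Euc m × Euc m => g p.1 * gs (σ • (x - p.2))) (volume.prod volume) :=
            hi.mul_prod (gs_scale_int hm σ hσp x)
          refine hd.norm.mono' ?_ (Eventually.of_forall fun p => ?_)
          · have a1 : Measurable (fun p : Euc m × Euc m => gs (σ • (x - p.2))) := gm.comp (by fun_prop)
            have a2 : Measurable (fun p : Euc m × Euc m => gs (σ • (p.1 - p.2))) := gm.comp (by fun_prop)
            exact ((a1.mul a2).mul (h.meas.comp measurable_fst)).aestronglyMeasurable
          · simp only [Function.uncurry, norm_mul]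
            rw [Real.norm_of_nonneg (gs_pos (σ • (p.1 - p.2))).le]
            have := gs_le_one (σ • (p.1 - p.2))
            calc _ ≤ ‖gs (σ • (x - p.2))‖ * 1 * ‖g p.1‖ := by gcongr
              _ = _ := by ring
      _ = _ := by
          congr 1; ext z
          unfold hh
          rw [← integral_const_mul]
          congr 1; ext y
          rw [← gs_even (σ • (z - y)), ← smul_neg, neg_sub]; ring
  obtain ⟨A, hA0, hA⟩ := hh_bound hm 0
  have e2 : κ * ∫ x, g x * hh g s x = ∫ z, hh g σ z * hh g σ z := by
    calc κ * ∫ x, g x * hh g s x = ∫ x, ∫ z, g x * (gs (σ • (x - z)) * hh g σ z) := by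
          rw [← integral_const_mul]
          congr 1; ext x
          rw [integral_const_mul, ← e1]; ring
      _ = ∫ z, ∫ x, g x * (gs (σ • (x - z)) * hh g σ z) := by
          refine integral_integral_swap ?_
          have hhm : Measurable (fun z => hh g σ z) :=
            ((hh_meas2 h.meas).comp_measurable (measurable_prodMk_left (x := σ))).measurable
          have a2 : Measurable (fun p : Euc m × Euc m => gs (σ • (p.1 - p.2))) := gm.comp (by fun_prop)
          have hd : Integrable (fun p : Euc m × Euc m => g p.1 * gs (σ • (p.1 - p.2))) (volume.prod volume) := by
            have am : AEStronglyMeasurable (fun p : Euc m × Euc m => g p.1 * gs (σ • (p.1 - p.2)))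
                (volume.prod volume) := ((h.meas.comp measurable_fst).mul a2).aestronglyMeasurable
            rw [integrable_prod_iff am]
            refine ⟨Eventually.of_forall fun x => (gs_scale_int hm σ hσp x).const_mul (g x), ?_⟩
            have : ∀ x, ∫ y, ‖g x * gs (σ • (x - y))‖ = ‖g x‖ * ∫ y : Euc m, gs (σ • y) := by
              intro x
              simp_rw [norm_mul, Real.norm_of_nonneg (gs_pos _).le]
              rw [integral_const_mul, integral_sub_left_eq_self (fun z => gs (σ • z)) volume]
            simp_rw [this]
            exact hi.norm.mul_const _
          refine (hd.norm.mul_const (C * A)).mono' ?_ (Eventually.of_forall fun p => ?_)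
          · exact ((h.meas.comp measurable_fst).mul (a2.mul (hhm.comp measurable_snd))).aestronglyMeasurable
          · simp only [Function.uncurry, norm_mul]
            have := (hA C g h σ hσp p.2).1
            rw [norm_iteratedFDeriv_zero, pow_zero, mul_one] at this
            rw [← mul_assoc]
            gcongr
      _ = _ := by
          congr 1; ext z
          have : ∀ x, g x * (gs (σ • (x - z)) * hh g σ z) = (gs (σ • (z - x)) * g x) * hh g σ z := by
            intro x
            rw [← gs_even (σ • (z - x)), ← smul_neg, neg_sub]; ring
          simp_rw [this]
          rw [integral_mul_const]; rfl
  have e3 : 0 ≤ κ * ∫ x, g x * hh g s x := by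
    rw [e2]; exact integral_nonneg fun z => mul_self_nonneg _
  exact nonneg_of_mul_nonneg_right e3 hκpos

lemma VV_energy (hm : 1 ≤ m) {C : ℝ} {g : Euc m → ℝ} (h : Cls C g) (h0 : ∫ y, g y = 0) :
    0 ≤ ∫ x, g x * VV g x := by
  obtain ⟨A, _, hA⟩ := VV_taylor hm
  obtain ⟨_, _, h3⟩ := hA C g h h0
  have e : ∫ x, g x * VV g x = ∫ s in Ioi (0:ℝ), ∫ x, g x * (hh g s x / s) := by
    unfold VV
    simp_rw [← integral_const_mul]
    refine integral_integral_swap ?_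
    have hd := (h.integrable hm).mul_prod (beta_int (C*A))
    refine hd.norm.mono' ?_ ?_
    · have a1 : Measurable (fun p : Euc m × ℝ => hh g p.2 p.1) :=
        ((hh_meas2 h.meas).comp_measurable measurable_swap).measurable
      exact ((h.meas.comp measurable_fst).mul (a1.div measurable_snd)).aestronglyMeasurable
    · have : ∀ᵐ p : Euc m × ℝ ∂((volume : Measure (Euc m)).prod (volume.restrict (Ioi (0:ℝ)))), p.2 ∈ Ioi (0:ℝ) :=
        Measure.quasiMeasurePreserving_snd.ae (ae_restrict_mem measurableSet_Ioi)
      filter_upwards [this] with p hp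
      simp only [Function.uncurry]
      rw [norm_mul, norm_mul]
      gcongr
      exact (h3 p.2 hp p.1).trans (le_abs_self _)
  rw [e]
  refine setIntegral_nonneg measurableSet_Ioi fun s hs => ?_
  have hs : 0 < s := hs
  simp_rw [← mul_div_assoc]
  rw [integral_div]
  exact div_nonneg (hh_pos hm h s hs) hs.le

end

section

variable {m : ℕ}

/-- nonnegative log kernel -/
def Nk (x y : Euc m) : ℝ := Real.log ((1+‖x‖) * (1+‖y‖) / ‖x - y‖)

lemma Nk_symm (x y : Euc m) : Nk x y = Nk y x := by
  unfold Nk; rw [mul_comm, norm_sub_rev]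

lemma Nk_nonneg (x y : Euc m) : 0 ≤ Nk x y := by
  unfold Nk
  rcases eq_or_ne (‖x - y‖) 0 with h | h
  · simp [h]
  · apply Real.log_nonneg
    rw [le_div_iff₀ (by positivity)]
    nlinarith [norm_sub_le x y, norm_nonneg x, norm_nonneg y, mul_nonneg (norm_nonneg x) (norm_nonneg y)]

lemma Nk_meas : Measurable (fun p : Euc m × Euc m => Nk p.1 p.2) := by
  unfold Nk
  fun_prop

lemma Nk_m {α : Type} [MeasurableSpace α] {f g : α → Euc m} (hf : Measurable f) (hg : Measurable g) :
    Measurable (fun a => Nk (f a) (g a)) := by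
  unfold Nk
  fun_prop

/-- local singular majorant -/
def qa (a : ℝ) (z : Euc m) : ℝ := (ball (0 : Euc m) 1).indicator (fun z => ‖z‖ ^ (-a)) z
/-- decaying majorant -/
def ra (a : ℝ) (z : Euc m) : ℝ := (1 + ‖z‖) ^ (-(4 * m - a : ℝ))

lemma qa_nonneg (a : ℝ) (z : Euc m) : 0 ≤ qa a z := by
  unfold qa; exact indicator_nonneg (fun z _ => by positivity) z
lemma ra_nonneg (a : ℝ) (z : Euc m) : 0 ≤ ra a z := by unfold ra; positivity

lemma qa_int (hm : 1 ≤ m) {a : ℝ} (ha : a < 2*m) : Integrable (qa a : Euc m → ℝ) := by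
  unfold qa
  rw [integrable_indicator_iff measurableSet_ball]
  refine integrableOn_ball_of_norm_le_rpow (C := 1) (α := a) (by simp; omega) (by simpa using ha) ?_
    (measurable_norm.pow_const _).aestronglyMeasurable
  refine Eventually.of_forall fun x => ?_
  rw [Real.norm_of_nonneg (by positivity), one_mul]

lemma ra_int {a : ℝ} (ha : a < 2*m) : Integrable (ra a : Euc m → ℝ) := by
  unfold ra
  apply integrable_one_add_norm
  simp; linarith

lemma bw_exp_le {a : ℝ} (ha0 : 0 < a) (ha : a < 2*m) (x y : Euc m) :
    bw x * Real.exp (a * Nk x y) ≤ 2^a * (ra a x + qa a (x-y) + 2^(4*m:ℝ) * ra a (x-y)) := by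
  have h2 : (1:ℝ) ≤ 2^a := Real.one_le_rpow (by norm_num) ha0.le
  have h2m : (1:ℝ) ≤ 2^(4*m:ℝ) := Real.one_le_rpow (by norm_num) (by positivity)
  have hr := ra_nonneg a x
  have hr' := ra_nonneg a (x-y)
  have hq := qa_nonneg a (x-y)
  have hu1 : 1 ≤ 1 + ‖x‖ := by linarith [norm_nonneg x]
  rcases eq_or_ne (‖x - y‖) 0 with h | h
  · have e : Nk x y = 0 := by unfold Nk; simp [h]
    rw [e, mul_zero, Real.exp_zero, mul_one]
    have : bw x ≤ ra a x := by
      unfold bw ra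
      exact Real.rpow_le_rpow_of_exponent_le hu1 (by linarith)
    have h3 : 0 ≤ 2^(4*m:ℝ) * ra a (x-y) := by positivity
    nlinarith
  have hv : 0 < ‖x - y‖ := by positivity
  have hw : 1 + ‖y‖ ≤ (1 + ‖x‖) + ‖x - y‖ := by
    have := norm_sub_norm_le y x
    rw [norm_sub_rev] at this; linarith
  have hw0 : 0 < 1 + ‖y‖ := by positivity
  have e : bw x * Real.exp (a * Nk x y)
      = (1+‖x‖)^(-(4*m-a:ℝ)) * (1+‖y‖)^a * ‖x-y‖^(-a) := by
    unfold bw Nk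
    rw [mul_comm a, Real.exp_mul, Real.exp_log (by positivity), Real.div_rpow (by positivity) hv.le,
      Real.mul_rpow (by positivity) (by positivity), Real.rpow_neg hv.le,
      show (-(4*m-a:ℝ)) = -(4*m:ℝ) + a by ring, Real.rpow_add (by positivity)]
    ring
  rw [e]
  have hq' : ‖x-y‖ < 1 → qa a (x-y) = ‖x-y‖^(-a) := fun hlt => by
    unfold qa; rw [indicator_of_mem]; simpa using hlt
  have hu : ra a x = (1+‖x‖)^(-(4*m-a:ℝ)) := rfl
  have hu' : ra a (x-y) = (1+‖x-y‖)^(-(4*m-a:ℝ)) := rfl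
  generalize ‖x - y‖ = v at *
  generalize 1 + ‖y‖ = w at *
  generalize 1 + ‖x‖ = u at *
  have hu0 : 0 < u := by linarith
  rcases le_or_gt u v with c | c
  · have h3 : w^a ≤ 2^a * v^a := by
      rw [← Real.mul_rpow (by norm_num) hv.le]
      exact Real.rpow_le_rpow hw0.le (by linarith) ha0.le
    have h4 : v^a * v^(-a) = 1 := by rw [← Real.rpow_add hv]; simp
    calc u^(-(4*m-a:ℝ)) * w^a * v^(-a) ≤ u^(-(4*m-a:ℝ)) * (2^a * v^a) * v^(-a) := by gcongr
      _ = 2^a * (ra a x) * (v^a * v^(-a)) := by rw [hu]; ring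
      _ = 2^a * ra a x := by rw [h4, mul_one]
      _ ≤ _ := by
        have h3 : 0 ≤ 2^(4*m:ℝ) * ra a (x-y) := by positivity
        have : 0 < (2:ℝ)^a := by positivity
        nlinarith
  · have h3 : w^a ≤ 2^a * u^a := by
      rw [← Real.mul_rpow (by norm_num) hu0.le]
      exact Real.rpow_le_rpow hw0.le (by linarith) ha0.le
    have h5 : u^(-(4*m-a:ℝ)) * w^a * v^(-a) ≤ 2^a * (u^(-(4*m-2*a:ℝ)) * v^(-a)) := by
      calc _ ≤ u^(-(4*m-a:ℝ)) * (2^a * u^a) * v^(-a) := by gcongr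
        _ = _ := by
          rw [show (-(4*m-2*a:ℝ)) = -(4*m-a:ℝ) + a by ring, Real.rpow_add hu0]; ring
    refine h5.trans ?_
    refine mul_le_mul_of_nonneg_left ?_ (by positivity)
    rcases lt_or_ge v 1 with d | d
    · rw [hq' d]
      have : u^(-(4*m-2*a:ℝ)) ≤ 1 := Real.rpow_le_one_of_one_le_of_nonpos hu1 (by linarith)
      have h6 : u^(-(4*m-2*a:ℝ)) * v^(-a) ≤ 1 * v^(-a) := by gcongr
      have h3 : 0 ≤ 2^(4*m:ℝ) * ra a (x-y) := by positivity
      linarith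
    · have h6 : u^(-(4*m-2*a:ℝ)) ≤ v^(-(4*m-2*a:ℝ)) :=
        Real.rpow_le_rpow_of_nonpos hv c.le (by linarith)
      have h7 : v^(-(4*m-2*a:ℝ)) * v^(-a) = v^(-(4*m-a:ℝ)) := by
        rw [← Real.rpow_add hv]; ring_nf
      have h8 : v^(-(4*m-a:ℝ)) ≤ ((1+v)/2)^(-(4*m-a:ℝ)) :=
        Real.rpow_le_rpow_of_nonpos (by linarith) (by linarith) (by linarith)
      have h9 : ((1+v)/2)^(-(4*m-a:ℝ)) = 2^(4*m-a:ℝ) * ra a (x-y) := by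
        rw [hu', Real.div_rpow (by linarith) (by norm_num), Real.rpow_neg (by norm_num : (0:ℝ) ≤ 2)]
        field_simp
      have h10 : (2:ℝ)^(4*m-a:ℝ) ≤ 2^(4*m:ℝ) :=
        Real.rpow_le_rpow_of_exponent_le (by norm_num) (by linarith)
      have h11 : u^(-(4*m-2*a:ℝ)) * v^(-a) ≤ v^(-(4*m-2*a:ℝ)) * v^(-a) := by gcongr
      have h12 : 2^(4*m-a:ℝ) * ra a (x-y) ≤ 2^(4*m:ℝ) * ra a (x-y) := by gcongr
      linarith

lemma exp_Nk_int (hm : 1 ≤ m) {a : ℝ} (ha0 : 0 < a) (ha : a < 2*m) : ∃ M : ℝ, ∀ y : Euc m,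
    Integrable (fun x => bw x * Real.exp (a * Nk x y)) ∧
      ∫ x, bw x * Real.exp (a * Nk x y) ≤ M := by
  refine ⟨(∫ x : Euc m, 2^a * (ra a x)) + ∫ x : Euc m, 2^a * (qa a x + 2^(4*m:ℝ) * ra a x), fun y => ?_⟩
  have i1 : Integrable (fun x : Euc m => 2^a * (ra a x)) := (ra_int ha).const_mul _
  have i2 : Integrable (fun x : Euc m => 2^a * (qa a x + 2^(4*m:ℝ) * ra a x)) :=
    ((qa_int hm ha).add ((ra_int ha).const_mul _)).const_mul _
  have i3 := i2.comp_sub_right y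
  have hb : ∀ x, bw x * Real.exp (a * Nk x y) ≤ 2^a * (ra a x) + 2^a * (qa a (x-y) + 2^(4*m:ℝ) * ra a (x-y)) := by
    intro x; have := bw_exp_le ha0 ha x y; linarith
  have h0 : ∀ x, 0 ≤ bw x * Real.exp (a * Nk x y) := fun x => mul_nonneg (bw_pos x).le (exp_pos _).le
  have hI : Integrable (fun x => bw x * Real.exp (a * Nk x y)) := by
    refine (i1.add i3).mono' ?_ (Eventually.of_forall fun x => ?_)
    · have h1 : Measurable (fun x => Nk x y) := Nk_m measurable_id measurable_const
      have h2 := (bw_cont (m := m)).measurable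
      exact (h2.mul (h1.const_mul a).exp).aestronglyMeasurable
    · rw [Real.norm_of_nonneg (h0 x)]; exact hb x
  refine ⟨hI, ?_⟩
  rw [← integral_sub_right_eq_self (fun x => 2^a * (qa a x + 2^(4*m:ℝ) * ra a x)) y, ← integral_add i1 i3]
  exact integral_mono hI (i1.add i3) hb

/-- log potential -/
def WW (g : Euc m → ℝ) (y : Euc m) : ℝ := ∫ x, Nk x y * g x

lemma bwNk (hm : 1 ≤ m) : ∃ M : ℝ, ∀ y : Euc m,
    Integrable (fun x => Nk x y * bw x) ∧ ∫ x, Nk x y * bw x ≤ M := by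
  have h1 : (1:ℝ) ≤ m := by exact_mod_cast hm
  obtain ⟨M, hM⟩ := exp_Nk_int hm (a := 1) (by norm_num) (by linarith)
  refine ⟨M, fun y => ?_⟩
  obtain ⟨hI, hle⟩ := hM y
  have hb : ∀ x, Nk x y * bw x ≤ bw x * Real.exp (1 * Nk x y) := by
    intro x
    rw [one_mul, mul_comm]
    have := Real.add_one_le_exp (Nk x y)
    have := bw_pos x
    gcongr; linarith
  have hJ : Integrable (fun x => Nk x y * bw x) := by
    refine hI.mono' ?_ (Eventually.of_forall fun x => ?_)
    · have h1 : Measurable (fun x => Nk x y) := Nk_m measurable_id measurable_const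
      have h2 := (bw_cont (m := m)).measurable
      exact (h1.mul h2).aestronglyMeasurable
    · rw [Real.norm_of_nonneg (mul_nonneg (Nk_nonneg _ _) (bw_pos x).le)]; exact hb x
  exact ⟨hJ, (integral_mono hJ hI hb).trans hle⟩

lemma Nk_g_int (hm : 1 ≤ m) {C : ℝ} {g : Euc m → ℝ} (h : Cls C g) (y : Euc m) :
    Integrable (fun x => Nk x y * g x) := by
  obtain ⟨M, hM⟩ := bwNk hm
  refine ((hM y).1.const_mul C).mono' ?_ (Eventually.of_forall fun x => ?_)
  · have h1 : Measurable (fun x => Nk x y) := Nk_m measurable_id measurable_const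
    exact (h1.mul h.meas).aestronglyMeasurable
  · rw [norm_mul, Real.norm_of_nonneg (Nk_nonneg _ _), Real.norm_eq_abs]
    have := h.bd x
    have := Nk_nonneg x y
    calc Nk x y * |g x| ≤ Nk x y * (C * bw x) := by gcongr
      _ = _ := by ring

lemma WW_meas {g : Euc m → ℝ} (hg : Measurable g) : Measurable (WW g) := by
  unfold WW
  have h1 : Measurable (fun q : Euc m × Euc m => Nk q.2 q.1) := Nk_m measurable_snd measurable_fst
  have h : StronglyMeasurable (fun q : Euc m × Euc m => Nk q.2 q.1 * g q.2) :=
    (h1.mul (hg.comp measurable_snd)).stronglyMeasurable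
  exact h.integral_prod_right.measurable

lemma WW_bd (hm : 1 ≤ m) : ∃ M : ℝ, 0 ≤ M ∧ ∀ (C : ℝ) (g : Euc m → ℝ), Cls C g → ∀ y, |WW g y| ≤ C * M := by
  obtain ⟨M, hM⟩ := bwNk hm
  refine ⟨M, (integral_nonneg fun x => mul_nonneg (Nk_nonneg _ _) (bw_pos x).le).trans (hM 0).2, fun C g h y => ?_⟩
  have hC := h.nonneg
  calc |WW g y| ≤ ∫ x, C * (Nk x y * bw x) := by
        refine norm_integral_le_of_norm_le (f := fun x => Nk x y * g x) ((hM y).1.const_mul C) (Eventually.of_forall fun x => ?_)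
        rw [norm_mul, Real.norm_of_nonneg (Nk_nonneg _ _), Real.norm_eq_abs]
        have := h.bd x
        have := Nk_nonneg x y
        calc Nk x y * |g x| ≤ Nk x y * (C * bw x) := by gcongr
          _ = _ := by ring
    _ = C * ∫ x, Nk x y * bw x := integral_const_mul _ _
    _ ≤ C * M := by gcongr; exact (hM y).2

lemma WW_symm (hm : 1 ≤ m) {C D : ℝ} {g k : Euc m → ℝ} (h : Cls C g) (hk : Cls D k) :
    ∫ y, WW g y * k y = ∫ x, g x * WW k x := by
  obtain ⟨M, hM⟩ := bwNk hm
  have hm1 : Measurable (fun p : Euc m × Euc m => Nk p.2 p.1 * g p.2 * k p.1) :=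
    ((Nk_m measurable_snd measurable_fst).mul (h.meas.comp measurable_snd)).mul (hk.meas.comp measurable_fst)
  have hI : Integrable (fun p : Euc m × Euc m => Nk p.2 p.1 * g p.2 * k p.1) (volume.prod volume) := by
    rw [integrable_prod_iff hm1.aestronglyMeasurable]
    refine ⟨Eventually.of_forall fun y => (Nk_g_int hm h y).mul_const (k y), ?_⟩
    have hh1 : AEStronglyMeasurable (fun y => ∫ x, ‖Nk x y * g x * k y‖) volume :=
      (hm1.norm.stronglyMeasurable.integral_prod_right (f := fun y x => ‖Nk x y * g x * k y‖)).aestronglyMeasurable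
    refine ((hk.integrable hm).norm.const_mul (C*M)).mono' hh1 (Eventually.of_forall fun y => ?_)
    simp_rw [norm_mul]
    rw [integral_mul_const, norm_mul, norm_norm]
    gcongr
    rw [Real.norm_of_nonneg (integral_nonneg fun x => by positivity)]
    have hC := h.nonneg
    calc ∫ x, ‖Nk x y‖ * ‖g x‖ ≤ ∫ x, C * (Nk x y * bw x) := by
          refine integral_mono_of_nonneg (Eventually.of_forall fun x => by positivity) ((hM y).1.const_mul C) (Eventually.of_forall fun x => ?_)
          have := h.bd x
          have h3 := Nk_nonneg x y
          simp only [Real.norm_eq_abs, abs_of_nonneg h3]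
          calc Nk x y * |g x| ≤ Nk x y * (C * bw x) := by gcongr
            _ = _ := by ring
      _ = C * ∫ x, Nk x y * bw x := integral_const_mul _ _
      _ ≤ C * M := by gcongr; exact (hM y).2
  calc ∫ y, WW g y * k y = ∫ y, ∫ x, Nk x y * g x * k y := by
        congr 1; ext y; rw [integral_mul_const]; rfl
    _ = ∫ x, ∫ y, Nk x y * g x * k y := integral_integral_swap hI
    _ = _ := by
        congr 1; ext x
        unfold WW
        rw [← integral_const_mul]
        congr 1; ext y; rw [Nk_symm]; ring

end

section

variable {m : ℕ}

/-- Frullani integrand -/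
def fr (r s : ℝ) : ℝ := (Real.exp (-(r*s)^2) - Real.exp (-s^2)) / s

lemma exp_neg_lip {a b : ℝ} (ha : 0 ≤ a) (hb : 0 ≤ b) : |Real.exp (-a) - Real.exp (-b)| ≤ |a - b| := by
  wlog h : a ≤ b generalizing a b
  · rw [abs_sub_comm, abs_sub_comm a]; exact this hb ha (le_of_not_ge h)
  have h1 : Real.exp (-b) ≤ Real.exp (-a) := Real.exp_le_exp.2 (by linarith)
  rw [abs_of_nonneg (by linarith), abs_of_nonpos (by linarith)]
  have h2 : Real.exp (-b) = Real.exp (-a) * Real.exp (a - b) := by rw [← Real.exp_add]; congr 1; ring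
  have h3 := Real.add_one_le_exp (a-b)
  have h4 : Real.exp (-a) ≤ 1 := Real.exp_le_one_iff.2 (by linarith)
  have h5 := Real.exp_pos (-a)
  rw [h2]; nlinarith

lemma fr_int {r : ℝ} (hr : 0 < r) : IntegrableOn (fr r) (Ioi 0) := by
  have g1 : Integrable (fun s : ℝ => Real.exp (-r^2 * s^2)) := integrable_exp_neg_mul_sq (by positivity)
  have g2 : Integrable (fun s : ℝ => Real.exp (-1 * s^2)) := integrable_exp_neg_mul_sq (by positivity)
  have g3 : Integrable ((Ioc (0:ℝ) 1).indicator (fun _ => |r^2-1|)) := by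
    rw [integrable_indicator_iff measurableSet_Ioc]
    simp
  have hd := ((g3.add g1).add g2).restrict (s := Ioi 0)
  refine hd.mono' ?_ ?_
  · unfold fr; exact (by fun_prop : Measurable _).aestronglyMeasurable
  · filter_upwards [ae_restrict_mem measurableSet_Ioi] with s hs
    have hs : 0 < s := hs
    unfold fr
    simp only [Pi.add_apply]
    have e1 : Real.exp (-(r*s)^2) = Real.exp (-r^2*s^2) := by congr 1; ring
    have e2 : Real.exp (-s^2) = Real.exp (-1*s^2) := by congr 1; ring
    rw [norm_div, Real.norm_of_nonneg hs.le, Real.norm_eq_abs, div_le_iff₀ hs]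
    have p1 := Real.exp_pos (-r^2*s^2)
    have p2 := Real.exp_pos (-1*s^2)
    rcases le_or_gt s 1 with c | c
    · rw [indicator_of_mem (show s ∈ Ioc (0:ℝ) 1 from ⟨hs, c⟩)]
      have := exp_neg_lip (sq_nonneg (r*s)) (sq_nonneg s)
      rw [show (r*s)^2 - s^2 = (r^2-1)*s^2 by ring, abs_mul, abs_of_nonneg (sq_nonneg s)] at this
      have h1 : |r^2-1| * s^2 ≤ |r^2-1| * s := by
        gcongr; nlinarith
      have h2 : 0 ≤ (Real.exp (-r^2*s^2) + Real.exp (-1*s^2)) * s := by positivity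
      nlinarith
    · rw [indicator_of_notMem (fun h => by linarith [h.2]), e1, e2]
      have : |Real.exp (-r^2*s^2) - Real.exp (-1*s^2)| ≤ Real.exp (-r^2*s^2) + Real.exp (-1*s^2) := by
        rw [abs_le]; constructor <;> linarith
      nlinarith

lemma fr_integral {r : ℝ} (hr : 0 < r) : ∫ s in Ioi (0:ℝ), fr r s = - Real.log r := by
  have h := Frullani.integral_Ioi_eq (f := fun s : ℝ => Real.exp (-s^2)) (a := r) (b := 1) (L := 1) (R := 0)
    ((by fun_prop : Continuous fun s : ℝ => Real.exp (-s^2)).locallyIntegrable.locallyIntegrableOn _) hr one_pos ?_ ?_ ?_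
  · simp only [one_mul, smul_eq_mul, sub_zero, mul_one, one_div, Real.log_inv] at h
    rw [← h]
    unfold fr
    simp_rw [div_eq_inv_mul]
  · have : Continuous fun s : ℝ => Real.exp (-s^2) := by fun_prop
    have := this.tendsto 0
    simp only [ne_eq, OfNat.ofNat_ne_zero, not_false_eq_true, zero_pow, neg_zero, Real.exp_zero] at this
    exact this.mono_left nhdsWithin_le_nhds
  · refine Real.tendsto_exp_atBot.comp (tendsto_neg_atTop_atBot.comp (tendsto_pow_atTop (by norm_num)))
  · have := fr_int hr
    unfold fr at this
    simpa [div_eq_inv_mul] using this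

lemma fr_abs {r : ℝ} (hr : 0 < r) : ∫ s in Ioi (0:ℝ), ‖fr r s‖ = |Real.log r| := by
  rcases le_or_gt r 1 with c | c
  · have : ∀ s ∈ Ioi (0:ℝ), ‖fr r s‖ = fr r s := by
      intro s hs
      have hs : 0 < s := hs
      rw [Real.norm_of_nonneg]
      refine div_nonneg ?_ hs.le
      have : Real.exp (-s^2) ≤ Real.exp (-(r*s)^2) := by
        apply Real.exp_le_exp.2
        have : (r*s)^2 ≤ s^2 := by gcongr; nlinarith
        linarith
      linarith
    rw [setIntegral_congr_fun measurableSet_Ioi this, fr_integral hr, abs_of_nonpos (Real.log_nonpos hr.le c)]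
  · have : ∀ s ∈ Ioi (0:ℝ), ‖fr r s‖ = - fr r s := by
      intro s hs
      have hs : 0 < s := hs
      rw [Real.norm_of_nonpos]
      refine div_nonpos_of_nonpos_of_nonneg ?_ hs.le
      have : Real.exp (-(r*s)^2) ≤ Real.exp (-s^2) := by
        apply Real.exp_le_exp.2
        have : s^2 ≤ (r*s)^2 := by gcongr; nlinarith
        linarith
      linarith
    rw [setIntegral_congr_fun measurableSet_Ioi this, integral_neg, fr_integral hr, neg_neg, abs_of_nonneg (Real.log_nonneg c.le)]

lemma logJ_bd (y : Euc m) : 0 ≤ Real.log (1+‖y‖) ∧ Real.log (1+‖y‖) ≤ ‖y‖ := by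
  have h := norm_nonneg y
  refine ⟨Real.log_nonneg (by linarith), ?_⟩
  have := Real.log_le_sub_one_of_pos (show 0 < 1+‖y‖ by linarith)
  linarith

lemma logJ_int (hm : 1 ≤ m) {C : ℝ} {g : Euc m → ℝ} (h : Cls C g) :
    Integrable (fun y => Real.log (1+‖y‖) * g y) := by
  refine ((bw_norm_int hm).const_mul C).mono' ?_ (Eventually.of_forall fun y => ?_)
  · exact ((by fun_prop : Measurable fun y : Euc m => Real.log (1+‖y‖)).mul h.meas).aestronglyMeasurable
  · obtain ⟨h1, h2⟩ := logJ_bd y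
    rw [norm_mul, Real.norm_of_nonneg h1, Real.norm_eq_abs]
    calc _ ≤ ‖y‖ * (C * bw y) := by gcongr; exact h.bd y
      _ = _ := by ring

lemma log_eq (x y : Euc m) (h : y ≠ x) :
    - Real.log ‖x - y‖ = Nk y x - Real.log (1+‖x‖) - Real.log (1+‖y‖) := by
  unfold Nk
  have : ‖y - x‖ ≠ 0 := by simpa [sub_eq_zero] using h
  rw [Real.log_div (by positivity) this, Real.log_mul (by positivity) (by positivity), norm_sub_rev]
  ring

lemma ae_ne' (hm : 1 ≤ m) (x : Euc m) : ∀ᵐ y : Euc m, y ≠ x := by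
  have : Nontrivial (Euc m) := Module.nontrivial_of_finrank_pos (R := ℝ) (by simp; omega)
  exact Measure.ae_ne _ x

lemma link (hm : 1 ≤ m) {C : ℝ} {g : Euc m → ℝ} (h : Cls C g) (h0 : ∫ y, g y = 0) (x : Euc m) :
    WW g x = VV g x + ∫ y, Real.log (1+‖y‖) * g y := by
  have hi := h.integrable hm
  have hl := logJ_int hm h
  have hN := Nk_g_int hm h x
  have hm0 : Measurable (fun p : Euc m × ℝ => g p.1 * fr ‖x - p.1‖ p.2) := by
    unfold fr
    refine (h.meas.comp measurable_fst).mul ?_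
    fun_prop
  have hF : Integrable (fun p : Euc m × ℝ => g p.1 * fr ‖x - p.1‖ p.2)
      (volume.prod (volume.restrict (Ioi 0))) := by
    rw [integrable_prod_iff hm0.aestronglyMeasurable]
    constructor
    · filter_upwards [ae_ne' hm x] with y hy
      exact (fr_int (norm_pos_iff.2 (sub_ne_zero.2 hy.symm))).const_mul (g y)
    · have hd := (hN.norm.add (hi.norm.const_mul (Real.log (1+‖x‖)))).add hl.norm
      refine hd.mono' (hm0.norm.stronglyMeasurable.integral_prod_right
        (f := fun y s => ‖g y * fr ‖x - y‖ s‖)).aestronglyMeasurable ?_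
      filter_upwards [ae_ne' hm x] with y hy
      have hp : 0 < ‖x - y‖ := norm_pos_iff.2 (sub_ne_zero.2 hy.symm)
      simp_rw [norm_mul]
      rw [integral_const_mul, fr_abs hp]
      simp only [Pi.add_apply, norm_mul]
      have e := log_eq x y hy
      have p1 := (logJ_bd x).1
      have p2 := (logJ_bd y).1
      have p3 := Nk_nonneg y x
      have h4 : |Real.log ‖x-y‖| ≤ Nk y x + Real.log (1+‖x‖) + Real.log (1+‖y‖) := by
        rw [abs_le]; constructor <;> linarith
      rw [norm_norm, Real.norm_eq_abs |Real.log _|, abs_abs, Real.norm_of_nonneg p2, Real.norm_of_nonneg p3]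
      nlinarith [norm_nonneg (g y)]
  have e1 : VV g x = ∫ s in Ioi (0:ℝ), ∫ y, g y * fr ‖x - y‖ s := by
    unfold VV
    refine setIntegral_congr_fun measurableSet_Ioi fun s hs => ?_
    have hs : 0 < s := hs
    have a1 : Integrable (fun y => gs (s • (x - y)) * g y) := by
      refine hi.norm.mono' ?_ (Eventually.of_forall fun y => ?_)
      · have := (gs_cont (m := m)).measurable
        exact ((this.comp (by fun_prop)).mul h.meas).aestronglyMeasurable
      · rw [norm_mul, Real.norm_of_nonneg (gs_pos _).le, Real.norm_eq_abs]
        nlinarith [abs_nonneg (g y), gs_le_one (s • (x - y))]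
    have a2 : ∀ y, g y * fr ‖x - y‖ s = (gs (s • (x - y)) * g y - Real.exp (-s^2) * g y) / s := by
      intro y
      unfold fr gs
      rw [norm_smul, Real.norm_of_nonneg hs.le, mul_comm s]; ring
    simp_rw [a2]
    rw [integral_div, integral_sub a1 (hi.const_mul _), integral_const_mul, h0, mul_zero, sub_zero]; rfl
  rw [e1, ← integral_integral_swap (f := fun y s => g y * fr ‖x - y‖ s) hF]
  have e2 : ∫ y, ∫ s in Ioi (0:ℝ), g y * fr ‖x - y‖ s
      = ∫ y, (Nk y x * g y - Real.log (1+‖x‖) * g y - Real.log (1+‖y‖) * g y) := by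
    refine integral_congr_ae ?_
    filter_upwards [ae_ne' hm x] with y hy
    have hp : 0 < ‖x - y‖ := norm_pos_iff.2 (sub_ne_zero.2 hy.symm)
    rw [integral_const_mul, fr_integral hp, log_eq x y hy]; ring
  have hc : Integrable (fun y => Nk y x * g y - Real.log (1+‖x‖) * g y) := hN.sub (hi.const_mul _)
  rw [e2, integral_sub hc hl, integral_sub hN (hi.const_mul _), integral_const_mul, h0]
  unfold WW; ring

lemma WW_energy (hm : 1 ≤ m) {C : ℝ} {g : Euc m → ℝ} (h : Cls C g) (h0 : ∫ y, g y = 0) :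
    0 ≤ ∫ x, g x * WW g x := by
  have h1 := VV_energy hm h h0
  simp_rw [link hm h h0, mul_add]
  obtain ⟨A, _, hA⟩ := WW_bd hm
  have hi := h.integrable hm
  have hV : Integrable (fun x => g x * VV g x) := by
    have : ∀ x, VV g x = WW g x - ∫ y, Real.log (1+‖y‖) * g y := fun x => by rw [link hm h h0]; ring
    have hW : Integrable (fun x => g x * WW g x) :=
      hi.mul_bdd (c := C * A) (WW_meas h.meas).aestronglyMeasurable (Eventually.of_forall fun x => hA C g h x)
    simp_rw [this, mul_sub]
    exact hW.sub (hi.mul_const _)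
  rw [integral_add hV (hi.mul_const _), integral_mul_const, h0]
  simpa using h1

end

section

variable {m : ℕ}

/-- test functions -/
structure Tst {m : ℕ} (φ : Euc m → ℝ) : Prop where
  sm : ContDiff ℝ (⊤ : ℕ∞) φ
  cs : HasCompactSupport φ

lemma Tst.fd {φ : Euc m → ℝ} (h : Tst φ) (v : Euc m) : Tst (fun x => fderiv ℝ φ x v) :=
  ⟨(h.sm.fderiv_right (m := (⊤ : ℕ∞)) (by exact_mod_cast le_rfl)).clm_apply contDiff_const, h.cs.fderiv_apply ℝ v⟩

lemma Tst.sum {ι : Type} (s : Finset ι) {φ : ι → Euc m → ℝ} (h : ∀ i, Tst (φ i)) :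
    Tst (fun x => ∑ i ∈ s, φ i x) := by
  classical
  induction s using Finset.induction_on with
  | empty => simp only [Finset.sum_empty]; exact ⟨contDiff_const, HasCompactSupport.zero⟩
  | insert a s ha ih =>
    simp only [Finset.sum_insert ha]
    exact ⟨(h a).sm.add ih.sm, (h a).cs.add ih.cs⟩

lemma Tst.neg {φ : Euc m → ℝ} (h : Tst φ) : Tst (fun x => -φ x) :=
  ⟨h.sm.neg, h.cs.neg⟩

lemma Tst.lap {φ : Euc m → ℝ} (h : Tst φ) : Tst (lap φ) := by
  unfold _root_.lap
  exact Tst.sum _ fun i => (h.fd _).fd _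

lemma Tst.pw {φ : Euc m → ℝ} (h : Tst φ) (j : ℕ) : Tst (negLapPow j φ) := by
  induction j with
  | zero => exact h
  | succ j ih =>
    unfold negLapPow at *
    rw [Function.iterate_succ_apply']
    exact ih.lap.neg

lemma Tst.bdd {φ : Euc m → ℝ} (h : Tst φ) : ∃ M, ∀ x, |φ x| ≤ M :=
  h.cs.exists_bound_of_continuous h.sm.continuous

lemma Tst.int {φ : Euc m → ℝ} (h : Tst φ) : Integrable φ :=
  h.sm.continuous.integrable_of_hasCompactSupport h.cs

lemma Tst.diff {φ : Euc m → ℝ} (h : Tst φ) : Differentiable ℝ φ := h.sm.differentiable (by simp)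

lemma Tst.cls {φ : Euc m → ℝ} (h : Tst φ) : ∃ C, Cls C φ := by
  have hc : Continuous (fun x => φ x / bw x) := h.sm.continuous.div bw_cont fun x => (bw_pos x).ne'
  have hs : HasCompactSupport (fun x => φ x / bw x) := by
    have : (fun x => φ x / bw x) = fun x => φ x * (bw x)⁻¹ := by ext; rw [div_eq_mul_inv]
    rw [this]; exact h.cs.mul_right
  obtain ⟨C, hC⟩ := hs.exists_bound_of_continuous hc
  refine ⟨C, h.sm.continuous.measurable, fun x => ?_⟩
  have := hC x
  rwa [norm_div, Real.norm_of_nonneg (bw_pos x).le, div_le_iff₀ (bw_pos x)] at this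

lemma Tst.int_fd {φ : Euc m → ℝ} (h : Tst φ) (v : Euc m) : ∫ x, fderiv ℝ φ x v = 0 := by
  have := integral_mul_fderiv_eq_neg_fderiv_mul_of_integrable (μ := (volume : Measure (Euc m)))
    (f := fun _ : Euc m => (1:ℝ)) (g := φ) (v := v) (by simp) (by simpa using (h.fd v).int) (by simpa using h.int)
    (fun x _ => by fun_prop) (fun x _ => h.diff x)
  simpa using this

lemma Tst.int_lap {φ : Euc m → ℝ} (h : Tst φ) : ∫ x, _root_.lap φ x = 0 := by
  unfold _root_.lap
  rw [integral_finsetSum _ fun i _ => ((h.fd _).fd _).int]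
  exact Finset.sum_eq_zero fun i _ => (h.fd _).int_fd _

lemma Tst.int_pw {φ : Euc m → ℝ} (h : Tst φ) (hm : 1 ≤ m) : ∫ x, negLapPow m φ x = 0 := by
  obtain ⟨j, rfl⟩ : ∃ j, m = j + 1 := ⟨m - 1, by omega⟩
  have := (h.pw j).int_lap
  unfold negLapPow at *
  rw [Function.iterate_succ_apply', integral_neg, this, neg_zero]

lemma gs_int (hm : 1 ≤ m) : Integrable (gs : Euc m → ℝ) := by
  have := gs_scale_int hm 1 one_pos (0 : Euc m)
  simpa [gs_even] using this

lemma gs_norm_int (hm : 1 ≤ m) : Integrable (fun z : Euc m => ‖z‖ * gs z) := by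
  obtain ⟨A, hA0, hA⟩ := gs_deriv m 0
  refine ((bw_norm_int hm).const_mul A).mono' (by have := gs_cont (m := m); fun_prop) (Eventually.of_forall fun z => ?_)
  have := hA z
  rw [norm_iteratedFDeriv_zero, Real.norm_of_nonneg (gs_pos z).le] at this
  rw [Real.norm_of_nonneg (mul_nonneg (norm_nonneg _) (gs_pos z).le)]
  calc ‖z‖ * gs z ≤ ‖z‖ * (A * bw z) := by gcongr
    _ = _ := by ring

/-- Gaussian average -/
def UU (φ : Euc m → ℝ) (y : Euc m) (t : ℝ) : ℝ := ∫ z, gs z * φ (y + t • z)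

lemma gs_fd (z v : Euc m) : fderiv ℝ gs z v = -2 * inner ℝ z v * gs z := by
  have h : HasFDerivAt (gs : Euc m → ℝ) (Real.exp (-‖z‖^2) • -((2:ℕ) • (innerSL ℝ z : Euc m →L[ℝ] ℝ))) z :=
    ((hasStrictFDerivAt_norm_sq z).hasFDerivAt.neg).exp
  rw [h.fderiv]
  simp [gs]; ring

lemma inner_single' (z : Euc m) (i : Fin (2*m)) : inner ℝ z (EuclideanSpace.single i (1:ℝ)) = z i := by
  simp [EuclideanSpace.inner_single_right]

lemma gs_mul_int (hm : 1 ≤ m) {φ : Euc m → ℝ} (h : Tst φ) (y : Euc m) (t : ℝ) :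
    Integrable (fun z => gs z * φ (y + t • z)) := by
  obtain ⟨M, hM⟩ := h.bdd
  refine (gs_int hm).mul_bdd (c := M) ?_ (Eventually.of_forall fun z => hM _)
  have := h.sm.continuous
  exact (by fun_prop : Continuous _).aestronglyMeasurable

lemma UU_ibp (hm : 1 ≤ m) {φ : Euc m → ℝ} (h : Tst φ) (y : Euc m) (t : ℝ) (i : Fin (2*m)) :
    ∫ z, gs z * (z i * φ (y + t • z))
      = (t/2) * ∫ z, gs z * fderiv ℝ φ (y + t • z) (EuclideanSpace.single i (1:ℝ)) := by
  set e : Euc m := EuclideanSpace.single i (1:ℝ) with he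
  have hk : ∀ z, fderiv ℝ (fun z => φ (y + t • z)) z e = t * fderiv ℝ φ (y + t • z) e := by
    intro z
    have h1 : HasFDerivAt (fun z : Euc m => y + t • z) (t • ContinuousLinearMap.id ℝ (Euc m)) z :=
      ((hasFDerivAt_id z).const_smul t).const_add y
    have h2 := ((h.diff (y + t • z)).hasFDerivAt).comp z h1
    have h3 : fderiv ℝ (fun z => φ (y + t • z)) z = _ := h2.fderiv
    rw [h3]; simp
  obtain ⟨M, hM⟩ := h.bdd
  have hc := h.sm.continuous
  have gc := gs_cont (m := m)
  have gf : ∀ z, fderiv ℝ gs z e = -2 * (z i * gs z) := fun z => by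
    rw [gs_fd, he, inner_single']; ring
  have key := integral_mul_fderiv_eq_neg_fderiv_mul_of_integrable (μ := (volume : Measure (Euc m)))
    (f := fun z => φ (y + t • z)) (g := gs) (v := e) ?_ ?_ ?_ ?_ ?_
  · simp_rw [hk, gf] at key
    have e1 : ∫ z, φ (y + t • z) * (-2 * (z i * gs z)) = -2 * ∫ z, gs z * (z i * φ (y + t • z)) := by
      rw [← integral_const_mul]; congr 1; ext z; ring
    have e2 : ∫ z, t * fderiv ℝ φ (y + t • z) e * gs z = t * ∫ z, gs z * fderiv ℝ φ (y + t • z) e := by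
      rw [← integral_const_mul]; congr 1; ext z; ring
    rw [e1, e2] at key
    linarith
  · simp_rw [hk]
    refine ((gs_mul_int hm (h.fd e) y t).const_mul t).congr (Eventually.of_forall fun z => ?_)
    simp only; ring
  · simp_rw [gf]
    refine ((gs_norm_int hm).const_mul (2*M)).mono' (by fun_prop) (Eventually.of_forall fun z => ?_)
    rw [norm_mul, norm_mul, norm_mul, Real.norm_of_nonneg (gs_pos z).le]
    have h1 := hM (y + t • z)
    have h2 : ‖z i‖ ≤ ‖z‖ := PiLp.norm_apply_le z i
    have h3 := gs_pos z
    have hM0 : 0 ≤ M := (abs_nonneg _).trans h1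
    calc ‖φ (y + t • z)‖ * (‖(-2:ℝ)‖ * (‖z i‖ * gs z)) ≤ M * (2 * (‖z‖ * gs z)) := by
          rw [show ‖(-2:ℝ)‖ = 2 by norm_num]
          gcongr; exact h1
      _ = _ := by ring
  · refine (gs_mul_int hm h y t).congr (Eventually.of_forall fun z => ?_)
    simp only; ring
  · intro z _
    exact (h.diff _).comp z (by fun_prop)
  · intro z _
    exact gs_contDiff.differentiable (by simp) z

lemma UU_deriv (hm : 1 ≤ m) {φ : Euc m → ℝ} (h : Tst φ) (y : Euc m) (t : ℝ) :
    HasDerivAt (UU φ y) (-(t/2) * UU (fun x => -lap φ x) y t) t := by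
  have hc := h.sm.continuous
  have gc := gs_cont (m := m)
  have hfc : Continuous (fderiv ℝ φ) := h.sm.continuous_fderiv (by simp)
  obtain ⟨M, hM⟩ := (h.cs.fderiv ℝ).exists_bound_of_continuous hfc
  have hd : ∀ (t : ℝ) (z : Euc m), HasDerivAt (fun t => gs z * φ (y + t • z)) (gs z * fderiv ℝ φ (y + t • z) z) t := by
    intro t z
    have h1 : HasDerivAt (fun t : ℝ => y + t • z) ((1:ℝ) • z) t := ((hasDerivAt_id t).smul_const z).const_add y
    rw [one_smul] at h1
    exact ((h.diff _).hasFDerivAt.comp_hasDerivAt t h1).const_mul _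
  have key := (hasDerivAt_integral_of_dominated_loc_of_deriv_le (μ := (volume : Measure (Euc m)))
    (F := fun t z => gs z * φ (y + t • z)) (F' := fun t z => gs z * fderiv ℝ φ (y + t • z) z)
    (bound := fun z => M * (‖z‖ * gs z)) (x₀ := t) (s := univ) univ_mem
    (Eventually.of_forall fun t => (gs_mul_int hm h y t).aestronglyMeasurable) (gs_mul_int hm h y t)
    (by
      have : Continuous fun z : Euc m => fderiv ℝ φ (y + t • z) z :=
        (hfc.comp (by fun_prop)).clm_apply continuous_id
      exact (gc.mul this).aestronglyMeasurable)
    (Eventually.of_forall fun z t _ => by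
      rw [norm_mul, Real.norm_of_nonneg (gs_pos z).le]
      have h3 := gs_pos z
      calc gs z * ‖fderiv ℝ φ (y + t • z) z‖ ≤ gs z * (M * ‖z‖) := by
            gcongr
            exact ((fderiv ℝ φ (y + t • z)).le_opNorm z).trans (by gcongr; exact hM _)
        _ = _ := by ring)
    ((gs_norm_int hm).const_mul M)
    (Eventually.of_forall fun z t _ => hd t z)).2
  suffices hs : ∫ z, gs z * fderiv ℝ φ (y + t • z) z = -(t/2) * UU (fun x => -lap φ x) y t by
    rw [hs] at key; exact key
  have e1 : ∀ z : Euc m, fderiv ℝ φ (y + t • z) z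
      = ∑ i : Fin (2*m), z i * fderiv ℝ φ (y + t • z) (EuclideanSpace.single i (1:ℝ)) := by
    intro z
    have : z = ∑ i : Fin (2*m), z i • EuclideanSpace.single i (1:ℝ) := by
      ext j; simp [Finset.sum_apply, Pi.single_apply]
    generalize fderiv ℝ φ (y + t • z) = L
    conv_lhs => rw [this]
    rw [map_sum]
    simp
  have e0 : ∫ z, gs z * fderiv ℝ φ (y + t • z) z = ∫ z, ∑ i : Fin (2*m),
      gs z * (z i * fderiv ℝ φ (y + t • z) (EuclideanSpace.single i (1:ℝ))) := by
    congr 1; ext z; rw [e1, Finset.mul_sum]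
  rw [e0]
  have iI : ∀ i : Fin (2*m), Integrable (fun z : Euc m => gs z * (z i * fderiv ℝ φ (y + t • z) (EuclideanSpace.single i (1:ℝ)))) := by
    intro i
    obtain ⟨M, hM⟩ := (h.fd (EuclideanSpace.single i (1:ℝ))).bdd
    have := (h.fd (EuclideanSpace.single i (1:ℝ))).sm.continuous
    refine ((gs_norm_int hm).const_mul M).mono' ?_ (Eventually.of_forall fun z => ?_)
    · have h2 : Continuous (fun z : Euc m => fderiv ℝ φ (y + t • z) (EuclideanSpace.single i (1:ℝ))) :=
        this.comp (by fun_prop)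
      exact (gc.mul ((by fun_prop : Continuous fun z : Euc m => z i).mul h2)).aestronglyMeasurable
    · rw [norm_mul, norm_mul, Real.norm_of_nonneg (gs_pos z).le]
      have h2 : ‖z i‖ ≤ ‖z‖ := PiLp.norm_apply_le z i
      have h3 := gs_pos z
      calc _ ≤ gs z * (‖z‖ * M) := by gcongr; exact hM _
        _ = _ := by ring
  rw [integral_finsetSum _ fun i _ => iI i]
  simp_rw [UU_ibp hm (h.fd _) y t]
  rw [← Finset.mul_sum, ← integral_finsetSum _ fun i _ => gs_mul_int hm ((h.fd _).fd _) y t]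
  unfold UU lap
  simp_rw [mul_neg, Finset.mul_sum]
  rw [integral_neg]; ring

end

section

variable {m : ℕ}

lemma UU_hh (φ : Euc m → ℝ) (y : Euc m) {t : ℝ} (ht : 0 < t) :
    t^(2*m) * UU φ y t = hh φ t⁻¹ y := by
  have h1 := Measure.integral_comp_smul (volume : Measure (Euc m)) (fun x => gs (t⁻¹ • x) * φ (y + x)) t
  have h2 : UU φ y t = ∫ z : Euc m, (fun x => gs (t⁻¹ • x) * φ (y + x)) (t • z) := by
    unfold UU
    congr 1; ext z
    simp [smul_smul, inv_mul_cancel₀ ht.ne']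
  rw [h2, h1]
  have h3 : hh φ t⁻¹ y = ∫ x, gs (t⁻¹ • x) * φ (y + x) := by
    unfold hh
    rw [← integral_add_left_eq_self (fun x => gs (t⁻¹ • (y - x)) * φ x) y]
    congr 1; ext x
    rw [← gs_even, ← smul_neg]; congr 3; abel
  rw [h3]
  simp only [finrank_euclideanSpace, Fintype.card_fin, smul_eq_mul]
  rw [abs_of_pos (by positivity), ← mul_assoc, mul_inv_cancel₀ (by positivity), one_mul]

lemma hh_L1 {φ : Euc m → ℝ} (h : Tst φ) (s : ℝ) (y : Euc m) : |hh φ s y| ≤ ∫ x, |φ x| := by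
  refine norm_integral_le_of_norm_le (f := fun x => gs (s • (y - x)) * φ x) h.int.abs (Eventually.of_forall fun x => ?_)
  rw [norm_mul, Real.norm_of_nonneg (gs_pos _).le, Real.norm_eq_abs]
  nlinarith [abs_nonneg (φ x), gs_le_one (s • (y - x))]

lemma UU_decay (hm : 1 ≤ m) {φ : Euc m → ℝ} (h : Tst φ) (y : Euc m) (i : ℕ) (hi : i < m) (c : ℝ) :
    Tendsto (fun t => c * t^(2*i) * UU φ y t) atTop (𝓝 0) := by
  have h1 : Tendsto (fun t : ℝ => (|c| * ∫ x, |φ x|) * (t^(2*m-2*i))⁻¹) atTop (𝓝 0) := by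
    have := ((tendsto_pow_atTop (α := ℝ) (n := 2*m-2*i) (by omega)).inv_tendsto_atTop).const_mul (|c| * ∫ x, |φ x|)
    simpa using this
  refine squeeze_zero_norm' ?_ h1
  filter_upwards [eventually_gt_atTop 0] with t ht
  have h2 := hh_L1 h t⁻¹ y
  rw [← UU_hh φ y ht, abs_mul, abs_of_pos (by positivity)] at h2
  rw [norm_mul, norm_mul, Real.norm_of_nonneg (by positivity : 0 ≤ t^(2*i)), Real.norm_eq_abs, Real.norm_eq_abs]
  have e : t^(2*m) = t^(2*i) * t^(2*m-2*i) := by rw [← pow_add]; congr 1; omega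
  rw [e] at h2
  rw [← div_eq_mul_inv, le_div_iff₀ (by positivity)]
  have := abs_nonneg c
  calc |c| * t^(2*i) * |UU φ y t| * t^(2*m-2*i) = |c| * (t^(2*i) * t^(2*m-2*i) * |UU φ y t|) := by ring
    _ ≤ _ := by gcongr

/-- coefficients -/
def cc (i : ℕ) : ℝ := ((i.factorial : ℝ) * 4^i)⁻¹

lemma cc_succ (i : ℕ) : cc (i+1) * (2*(i+1)) = cc i / 2 := by
  unfold cc
  rw [Nat.factorial_succ, pow_succ]; push_cast
  have : (i.factorial : ℝ) ≠ 0 := by positivity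
  have : (i : ℝ) + 1 ≠ 0 := by positivity
  field_simp; norm_num

/-- partial sums -/
def BB (ψ : Euc m → ℝ) (y : Euc m) (n : ℕ) (t : ℝ) : ℝ :=
  ∑ i ∈ Finset.range n, cc i * t^(2*i) * UU (negLapPow i ψ) y t

lemma BB_deriv (hm : 1 ≤ m) {ψ : Euc m → ℝ} (h : Tst ψ) (y : Euc m) (n : ℕ) (t : ℝ) :
    HasDerivAt (BB ψ y n) (-(cc n * (2*n) * t^(2*n-1) * UU (negLapPow n ψ) y t)) t := by
  induction n with
  | zero =>
    have : BB ψ y 0 = fun _ => 0 := by ext; simp [BB]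
    rw [this]; simpa using hasDerivAt_const t (0:ℝ)
  | succ n ih =>
    have e : BB ψ y (n+1) = fun t => BB ψ y n t + cc n * t^(2*n) * UU (negLapPow n ψ) y t := by
      ext t; simp [BB, Finset.sum_range_succ]
    rw [e]
    have h1 := UU_deriv hm (h.pw n) y t
    have e2 : (fun x => -lap (negLapPow n ψ) x) = negLapPow (n+1) ψ := by
      unfold negLapPow; rw [Function.iterate_succ_apply']
    rw [e2] at h1
    have h2 := ((hasDerivAt_pow (2*n) t).const_mul (cc n)).mul h1
    refine (ih.add h2).congr_deriv ?_
    have h3 := cc_succ n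
    have e3 : t^(2*(n+1)-1) = t^(2*n) * t := by rw [← pow_succ]; congr 1
    push_cast
    rw [e3]
    linear_combination (t^(2*n)*t*UU (negLapPow (n+1) ψ) y t) * h3

lemma UU_zero (ψ : Euc m → ℝ) (y : Euc m) : UU ψ y 0 = π^m * ψ y := by
  unfold UU
  simp only [zero_smul, add_zero]
  rw [integral_mul_const]
  congr 1
  have := GaussianFourier.integral_rexp_neg_mul_sq_norm (V := Euc m) (b := 1) one_pos
  unfold gs
  simp only [neg_mul, one_mul, div_one, finrank_euclideanSpace, Fintype.card_fin] at this
  rw [this]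
  rw [show (((2*m : ℕ) : ℝ)/2) = (m:ℝ) by push_cast; ring, Real.rpow_natCast]

lemma VV_fund' (hm : 1 ≤ m) {ψ : Euc m → ℝ} (h : Tst ψ) (y : Euc m) :
    cc m * (2*m) * VV (negLapPow m ψ) y = π^m * ψ y := by
  set φ := negLapPow m ψ with hφ
  have hT : Tst φ := h.pw m
  obtain ⟨C, hC⟩ := hT.cls
  have h0 : ∫ x, φ x = 0 := h.int_pw hm
  obtain ⟨A, hA0, hA⟩ := VV_taylor hm
  obtain ⟨_, _, hb⟩ := hA C φ hC h0
  have e1 : ∀ t ∈ Ioi (0:ℝ), t^(2*m-1) * UU φ y t = t⁻¹ * hh φ t⁻¹ y := by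
    intro t ht
    have ht : 0 < t := ht
    rw [← UU_hh φ y ht, ← mul_assoc]
    congr 1
    rw [show t^(2*m) = t * t^(2*m-1) by rw [← pow_succ']; congr 1; omega, ← mul_assoc, inv_mul_cancel₀ ht.ne', one_mul]
  have e2 : VV φ y = ∫ t in Ioi (0:ℝ), t^(2*m-1) * UU φ y t := by
    unfold VV
    rw [← integral_comp_rpow_Ioi (fun s => hh φ s y / s) (p := -1) (by norm_num)]
    refine setIntegral_congr_fun measurableSet_Ioi fun t ht => ?_
    have ht' : 0 < t := ht
    simp only [e1 t ht, Real.rpow_neg_one, smul_eq_mul]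
    have : t^((-1:ℝ)-1) = t⁻¹ * t⁻¹ := by
      rw [show ((-1:ℝ)-1) = -1 + -1 by ring, Real.rpow_add ht', Real.rpow_neg_one]
    rw [this]; simp; field_simp
  have hinteg : IntegrableOn (fun t => -(cc m * (2*m) * t^(2*m-1) * UU φ y t)) (Ioi 0) := by
    have : IntegrableOn (fun t => t^(2*m-1) * UU φ y t) (Ioi 0) := by
      refine (beta_int (C*A)).mono' ?_ ?_
      · have hd : Continuous (UU φ y) := continuous_iff_continuousAt.2 fun t => (UU_deriv hm hT y t).continuousAt
        exact (by fun_prop : Continuous fun t => t^(2*m-1) * UU φ y t).aestronglyMeasurable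
      · filter_upwards [ae_restrict_mem measurableSet_Ioi] with t ht
        have ht' : 0 < t := ht
        rw [e1 t ht]
        have := hb t⁻¹ (by positivity) y
        have e4 : ‖t⁻¹ * hh φ t⁻¹ y‖ = (t^2)⁻¹ * |hh φ t⁻¹ y / t⁻¹| := by
          rw [norm_mul, abs_div, abs_of_pos (inv_pos.2 ht'), Real.norm_of_nonneg (inv_pos.2 ht').le, Real.norm_eq_abs]
          field_simp
        rw [e4]
        calc _ ≤ (t^2)⁻¹ * (C * A * (1 + t⁻¹^2)⁻¹) := by gcongr
          _ = C * A * (1+t^2)⁻¹ := by field_simp; ring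
    refine (this.const_mul (-(cc m * (2*m)))).congr (Eventually.of_forall fun t => ?_)
    simp only; ring
  have hlim : Tendsto (BB ψ y m) atTop (𝓝 0) := by
    have : Tendsto (BB ψ y m) atTop (𝓝 (∑ i ∈ Finset.range m, 0)) := by
      unfold BB
      refine tendsto_finsetSum _ fun i hi => ?_
      exact UU_decay hm (h.pw i) y i (Finset.mem_range.1 hi) _
    simpa using this
  have key := integral_Ioi_of_hasDerivAt_of_tendsto' (a := 0) (fun t _ => BB_deriv hm h y m t) hinteg hlim
  have hB0 : BB ψ y m 0 = π^m * ψ y := by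
    unfold BB
    obtain ⟨j, rfl⟩ : ∃ j, m = j + 1 := ⟨m - 1, by omega⟩
    rw [Finset.sum_range_succ']
    rw [Finset.sum_eq_zero]
    · simp [cc, UU_zero, negLapPow]
    · intro i _
      simp
  rw [hB0, integral_neg] at key
  have e5 : cc m * (2*m) * VV φ y = ∫ t in Ioi (0:ℝ), cc m * (2*m) * t^(2*m-1) * UU (negLapPow m ψ) y t := by
    rw [e2, ← integral_const_mul]
    congr 1; ext t; rw [← hφ]; ring
  linarith

lemma Lambda1_eq (hm : 1 ≤ m) : Lambda1 m = (4*π)^m * ((m-1).factorial : ℝ) := by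
  unfold Lambda1 sphereVol
  obtain ⟨j, rfl⟩ : ∃ j, m = j + 1 := ⟨m - 1, by omega⟩
  have h1 : (((2*(j+1) : ℕ) : ℝ) + 1)/2 = ((j+1 : ℕ):ℝ) + 1/2 := by push_cast; ring
  rw [h1, Real.Gamma_nat_add_half, Real.rpow_add Real.pi_pos, Real.rpow_natCast, ← Real.sqrt_eq_rpow]
  have h2 : 2*(j+1)-1 = 2*j+1 := by omega
  rw [h2, Nat.factorial_eq_mul_doubleFactorial, Nat.doubleFactorial_two_mul]
  have h3 : ((2*j+1).doubleFactorial : ℝ) ≠ 0 := by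
    have := Nat.doubleFactorial_pos (2*j+1); positivity
  have h4 : √π ≠ 0 := by have := Real.pi_pos; positivity
  push_cast
  field_simp
  rw [mul_pow, show (4:ℝ)^(j+1) = 2^(j+1) * 2^(j+1) by rw [← mul_pow]; norm_num]
  ring

lemma VV_fund (hm : 1 ≤ m) {ψ : Euc m → ℝ} (h : Tst ψ) (y : Euc m) :
    VV (negLapPow m ψ) y = Lambda1 m / 2 * ψ y := by
  have := VV_fund' hm h y
  rw [Lambda1_eq hm]
  obtain ⟨j, rfl⟩ : ∃ j, m = j + 1 := ⟨m - 1, by omega⟩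
  have hc := cc_succ j
  push_cast at this
  rw [hc] at this
  simp only [Nat.add_sub_cancel]
  unfold cc at this
  have h5 : (j.factorial : ℝ) ≠ 0 := by positivity
  field_simp at this
  rw [mul_pow, pow_succ 4]
  linear_combination (1/1) * this

lemma Lambda1_pos (hm : 1 ≤ m) : 0 < Lambda1 m := by
  rw [Lambda1_eq hm]; have := Real.pi_pos; positivity

lemma WW_dist (hm : 1 ≤ m) {C : ℝ} {g : Euc m → ℝ} (hg : Cls C g) (h0 : ∫ y, g y = 0)
    {ψ : Euc m → ℝ} (h : Tst ψ) :
    ∫ x, WW g x * negLapPow m ψ x = Lambda1 m / 2 * ∫ x, g x * ψ x := by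
  obtain ⟨D, hD⟩ := (h.pw m).cls
  rw [WW_symm hm hg hD]
  have h1 := h.int_pw hm
  simp_rw [link hm hD h1, VV_fund hm h, mul_add]
  have hi := hg.integrable hm
  obtain ⟨M, hM⟩ := h.bdd
  have i1 : Integrable (fun x => g x * (Lambda1 m / 2 * ψ x)) := by
    have := (hi.mul_bdd (c := M) h.sm.continuous.aestronglyMeasurable (Eventually.of_forall hM)).const_mul (Lambda1 m / 2)
    refine this.congr (Eventually.of_forall fun x => ?_)
    simp only; ring
  rw [integral_add i1 (hi.mul_const _), integral_mul_const, h0, zero_mul, add_zero, ← integral_const_mul]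
  congr 1; ext x; ring

end

section

variable {m : ℕ}

/-- problem data -/
structure Dat {m : ℕ} (K f : Euc m → ℝ) (Λ CK Cf : ℝ) : Prop where
  hm : 1 ≤ m
  hK : Cls CK K
  K0 : ∀ x, 0 ≤ K x
  Kpos : 0 < ∫ x, K x
  hf : Cls Cf f
  fint : ∫ x, f x = Λ
  Λ0 : 0 < Λ
  Λ1 : Λ < Lambda1 m

/-- bounded measurable -/
structure BM {m : ℕ} (B : ℝ) (w : Euc m → ℝ) : Prop where
  meas : Measurable w
  bd : ∀ x, |w x| ≤ B

/-- partition function -/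
def Zf (K w : Euc m → ℝ) : ℝ := ∫ x, K x * Real.exp (2*m * w x)
/-- normalizing constant -/
def cf (K : Euc m → ℝ) (Λ : ℝ) (w : Euc m → ℝ) : ℝ := (2*m : ℝ)⁻¹ * Real.log (Λ / Zf K w)
/-- normalized density -/
def ro (K : Euc m → ℝ) (Λ : ℝ) (w : Euc m → ℝ) (x : Euc m) : ℝ :=
  K x * Real.exp (2*m * (w x + cf K Λ w))
/-- source -/
def gg (K f : Euc m → ℝ) (Λ : ℝ) (w : Euc m → ℝ) (x : Euc m) : ℝ := ro K Λ w x - f x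
/-- the map -/
def TT (K f : Euc m → ℝ) (Λ : ℝ) (w : Euc m → ℝ) (x : Euc m) : ℝ := WW (gg K f Λ w) x / (Lambda1 m / 2)

section
variable {K f w v : Euc m → ℝ} {Λ CK Cf B : ℝ}

lemma Zf_bd (d : Dat K f Λ CK Cf) (hw : BM B w) : Integrable (fun x => K x * Real.exp (2*m * w x)) ∧
    Real.exp (-(2*m*B)) * ∫ x, K x ≤ Zf K w := by
  have hi := d.hK.integrable d.hm
  have hI : Integrable (fun x => K x * Real.exp (2*m * w x)) := by
    refine hi.mul_bdd (c := Real.exp (2*m*B)) ?_ (Eventually.of_forall fun x => ?_)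
    · exact ((hw.meas.const_mul _).exp).aestronglyMeasurable
    · rw [Real.norm_of_nonneg (Real.exp_pos _).le]
      have := (abs_le.1 (hw.bd x)).2
      gcongr
  refine ⟨hI, ?_⟩
  rw [← integral_const_mul]
  refine integral_mono (hi.const_mul _) hI fun x => ?_
  simp only
  rw [mul_comm]
  have := (abs_le.1 (hw.bd x)).1
  have := d.K0 x
  gcongr
  have : (0:ℝ) ≤ 2*m := by positivity
  nlinarith

lemma Zf_pos (d : Dat K f Λ CK Cf) (hw : BM B w) : 0 < Zf K w :=
  lt_of_lt_of_le (mul_pos (Real.exp_pos _) d.Kpos) (Zf_bd d hw).2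

lemma ro_eq (d : Dat K f Λ CK Cf) (hw : BM B w) (x : Euc m) :
    ro K Λ w x = K x * Real.exp (2*m * w x) * (Λ / Zf K w) := by
  unfold ro cf
  have hz := Zf_pos d hw
  have hm' : (m:ℝ) ≠ 0 := by have := d.hm; positivity
  rw [mul_add, Real.exp_add, ← mul_assoc (2*m:ℝ) (2*m:ℝ)⁻¹, mul_inv_cancel₀ (by positivity), one_mul,
    Real.exp_log (div_pos d.Λ0 hz)]
  ring

/-- the constant -/
def DD (K : Euc m → ℝ) (Λ CK B : ℝ) : ℝ := CK * Real.exp (2*m*B) * (Λ / (Real.exp (-(2*m*B)) * ∫ x, K x))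

lemma ro_nonneg (d : Dat K f Λ CK Cf) (w : Euc m → ℝ) (x : Euc m) : 0 ≤ ro K Λ w x :=
  mul_nonneg (d.K0 x) (Real.exp_pos _).le

lemma ro_cls (d : Dat K f Λ CK Cf) (hw : BM B w) : Cls (DD K Λ CK B) (ro K Λ w) := by
  refine ⟨?_, fun x => ?_⟩
  · unfold ro
    exact d.hK.meas.mul (((hw.meas.add_const _).const_mul _).exp)
  · rw [abs_of_nonneg (ro_nonneg d w x), ro_eq d hw]
    have h1 := (abs_of_nonneg (d.K0 x)) ▸ d.hK.bd x
    have h2 := (abs_le.1 (hw.bd x)).2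
    have h3 := (Zf_bd d hw).2
    have h4 : 0 < Real.exp (-(2*m*B)) * ∫ x, K x := mul_pos (Real.exp_pos _) d.Kpos
    have h5 := d.Λ0
    have h6 := bw_pos x
    have h7 := d.hK.nonneg
    have h8 : 0 ≤ Λ / Zf K w := (div_pos h5 (Zf_pos d hw)).le
    calc _ ≤ (CK * bw x) * Real.exp (2*m*B) * (Λ / (Real.exp (-(2*m*B)) * ∫ x, K x)) := by gcongr
      _ = _ := by unfold DD; ring

lemma ro_int (d : Dat K f Λ CK Cf) (hw : BM B w) : ∫ x, ro K Λ w x = Λ := by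
  simp_rw [ro_eq d hw]
  rw [integral_mul_const]
  have hz := Zf_pos d hw
  change Zf K w * _ = Λ
  field_simp

lemma gg_cls (d : Dat K f Λ CK Cf) (hw : BM B w) : Cls (DD K Λ CK B + Cf) (gg K f Λ w) := by
  have h1 := ro_cls d hw
  refine ⟨h1.meas.sub d.hf.meas, fun x => ?_⟩
  unfold gg
  rw [add_mul]
  exact (abs_sub _ _).trans (add_le_add (h1.bd x) (d.hf.bd x))

lemma gg_int (d : Dat K f Λ CK Cf) (hw : BM B w) : ∫ x, gg K f Λ w x = 0 := by
  unfold gg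
  rw [integral_sub ((ro_cls d hw).integrable d.hm) (d.hf.integrable d.hm), ro_int d hw, d.fint, sub_self]

lemma WW_sub (hm : 1 ≤ m) {C D : ℝ} {g k : Euc m → ℝ} (hg : Cls C g) (hk : Cls D k) (y : Euc m) :
    WW (fun x => g x - k x) y = WW g y - WW k y := by
  unfold WW
  simp_rw [mul_sub]
  exact integral_sub (Nk_g_int hm hg y) (Nk_g_int hm hk y)

lemma int_mul (hm : 1 ≤ m) {C B : ℝ} {g u : Euc m → ℝ} (hg : Cls C g) (hu : BM B u) :
    Integrable (fun x => g x * u x) :=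
  (hg.integrable hm).mul_bdd (c := B) hu.meas.aestronglyMeasurable (Eventually.of_forall hu.bd)

lemma BM_WW (hm : 1 ≤ m) {C : ℝ} {g : Euc m → ℝ} (hg : Cls C g) : ∃ B, BM B (WW g) := by
  obtain ⟨M, _, hM⟩ := WW_bd hm
  exact ⟨C*M, WW_meas hg.meas, hM C g hg⟩

lemma Cls_sub {C D : ℝ} {g k : Euc m → ℝ} (hg : Cls C g) (hk : Cls D k) : Cls (C + D) (fun x => g x - k x) :=
  ⟨hg.meas.sub hk.meas, fun x => by rw [add_mul]; exact (abs_sub _ _).trans (add_le_add (hg.bd x) (hk.bd x))⟩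

/-- convexity of energy -/
lemma energy_conv (hm : 1 ≤ m) {C D : ℝ} {g k : Euc m → ℝ} (hg : Cls C g) (hk : Cls D k)
    (g0 : ∫ x, g x = 0) (k0 : ∫ x, k x = 0) :
    2 * ∫ x, k x * WW g x ≤ (∫ x, k x * WW k x) + ∫ x, g x * WW g x := by
  have h1 := WW_energy hm (Cls_sub hk hg) (by
    rw [integral_sub (hk.integrable hm) (hg.integrable hm), g0, k0, sub_self])
  simp_rw [WW_sub hm hk hg] at h1
  obtain ⟨B1, b1⟩ := BM_WW hm hg
  obtain ⟨B2, b2⟩ := BM_WW hm hk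
  have e : ∀ x, (k x - g x) * (WW k x - WW g x) = (k x * WW k x - k x * WW g x) - (g x * WW k x - g x * WW g x) :=
    fun x => by ring
  simp_rw [e] at h1
  have i1 : Integrable (fun x => k x * WW k x - k x * WW g x) := (int_mul hm hk b2).sub (int_mul hm hk b1)
  have i2 : Integrable (fun x => g x * WW k x - g x * WW g x) := (int_mul hm hg b2).sub (int_mul hm hg b1)
  rw [integral_sub i1 i2, integral_sub (int_mul hm hk b2) (int_mul hm hk b1),
    integral_sub (int_mul hm hg b2) (int_mul hm hg b1)] at h1
  have h2 := WW_symm hm hg hk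
  have h3 : ∫ y, WW g y * k y = ∫ y, k y * WW g y := by congr 1; ext y; ring
  linarith

/-- entropy -/
def SS (K : Euc m → ℝ) (Λ : ℝ) (w : Euc m → ℝ) : ℝ := ∫ x, ro K Λ w x * (w x + cf K Λ w)
/-- free energy -/
def FF (K f : Euc m → ℝ) (Λ : ℝ) (w : Euc m → ℝ) : ℝ :=
  SS K Λ w - (Lambda1 m)⁻¹ * ∫ x, gg K f Λ w x * WW (gg K f Λ w) x
/-- relative entropy -/
def RR (K : Euc m → ℝ) (Λ : ℝ) (w v : Euc m → ℝ) : ℝ :=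
  ∫ x, ro K Λ w x * ((w x + cf K Λ w) - (v x + cf K Λ v))

lemma BM_add (hw : BM B w) (c : ℝ) : BM (B + |c|) (fun x => w x + c) :=
  ⟨hw.meas.add_const c, fun x => (abs_add_le _ _).trans (by gcongr; exact hw.bd x)⟩

lemma RR_pt (d : Dat K f Λ CK Cf) (w v : Euc m → ℝ) (x : Euc m) :
    ro K Λ w x - ro K Λ v x ≤ 2*m * (ro K Λ w x * ((w x + cf K Λ w) - (v x + cf K Λ v))) := by
  unfold ro
  set p := w x + cf K Λ w
  set q := v x + cf K Λ v
  have h1 : Real.exp (2*m*q) = Real.exp (2*m*p) * Real.exp (2*m*q - 2*m*p) := by rw [← Real.exp_add]; congr 1; ring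
  rw [h1]
  have h2 := Real.add_one_le_exp (2*m*q - 2*m*p)
  have h3 : 0 ≤ K x * Real.exp (2*m*p) := mul_nonneg (d.K0 x) (Real.exp_pos _).le
  nlinarith

lemma RR_i (d : Dat K f Λ CK Cf) {B' : ℝ} (hw : BM B w) (hv : BM B' v) :
    Integrable (fun x => ro K Λ w x * ((w x + cf K Λ w) - (v x + cf K Λ v))) := by
  have h1 := int_mul d.hm (ro_cls d hw) (BM_add hw (cf K Λ w))
  have h2 := int_mul d.hm (ro_cls d hw) (BM_add hv (cf K Λ v))
  simp_rw [mul_sub]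
  exact h1.sub h2

lemma RR_nonneg (d : Dat K f Λ CK Cf) {B' : ℝ} (hw : BM B w) (hv : BM B' v) : 0 ≤ RR K Λ w v := by
  have h1 : ∫ x, (ro K Λ w x - ro K Λ v x) ≤ ∫ x, 2*m * (ro K Λ w x * ((w x + cf K Λ w) - (v x + cf K Λ v))) :=
    integral_mono (((ro_cls d hw).integrable d.hm).sub ((ro_cls d hv).integrable d.hm))
      ((RR_i d hw hv).const_mul _) (RR_pt d w v)
  rw [integral_sub ((ro_cls d hw).integrable d.hm) ((ro_cls d hv).integrable d.hm), ro_int d hw, ro_int d hv,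
    sub_self, integral_const_mul] at h1
  have hm' : (0:ℝ) < 2*m := by have := d.hm; positivity
  exact nonneg_of_mul_nonneg_right h1 hm'

lemma TT_BM (d : Dat K f Λ CK Cf) (hw : BM B w) : ∃ B', BM B' (TT K f Λ w) := by
  obtain ⟨B1, b1⟩ := BM_WW d.hm (gg_cls d hw)
  have hp := Lambda1_pos d.hm
  refine ⟨B1 / (Lambda1 m / 2), b1.meas.div_const _, fun x => ?_⟩
  unfold TT
  rw [abs_div, abs_of_pos (show 0 < Lambda1 m / 2 by linarith)]
  gcongr
  exact b1.bd x

lemma FF_mono (d : Dat K f Λ CK Cf) (hw : BM B w) :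
    RR K Λ w (TT K f Λ w) ≤ FF K f Λ w - FF K f Λ (TT K f Λ w) := by
  obtain ⟨B', hv⟩ := TT_BM d hw
  have hWt : ∀ x, WW (gg K f Λ w) x = Lambda1 m / 2 * TT K f Λ w x := by
    intro x; unfold TT; have := Lambda1_pos d.hm; field_simp
  set v := TT K f Λ w with hvdef
  have hm := d.hm
  have hp := Lambda1_pos hm
  have g1 := gg_cls d hw
  have g2 := gg_cls d hv
  have hc := energy_conv hm g1 g2 (gg_int d hw) (gg_int d hv)
  have r1 := ro_cls d hw
  have r2 := ro_cls d hv
  have hwc := BM_add hw (cf K Λ w)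
  have hvc := BM_add hv (cf K Λ v)
  have e1 : ∫ x, gg K f Λ v x * WW (gg K f Λ w) x
      = Lambda1 m / 2 * ((∫ x, ro K Λ v x * v x) - ∫ x, f x * v x) := by
    rw [← integral_sub (int_mul hm r2 hv) (int_mul hm d.hf hv), ← integral_const_mul]
    congr 1; ext x; rw [hWt]; unfold gg; ring
  have e2 : ∫ x, gg K f Λ w x * WW (gg K f Λ w) x
      = Lambda1 m / 2 * ((∫ x, ro K Λ w x * v x) - ∫ x, f x * v x) := by
    rw [← integral_sub (int_mul hm r1 hv) (int_mul hm d.hf hv), ← integral_const_mul]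
    congr 1; ext x; rw [hWt]; unfold gg; ring
  have e3 : SS K Λ v = (∫ x, ro K Λ v x * v x) + Λ * cf K Λ v := by
    unfold SS
    simp_rw [mul_add]
    rw [integral_add (int_mul hm r2 hv) ((r2.integrable hm).mul_const _), integral_mul_const, ro_int d hv]
  have e4 : RR K Λ w v = SS K Λ w - ((∫ x, ro K Λ w x * v x) + Λ * cf K Λ v) := by
    unfold RR SS
    simp_rw [mul_sub]
    rw [integral_sub (int_mul hm r1 hwc) (int_mul hm r1 hvc)]
    congr 1
    simp_rw [mul_add]
    rw [integral_add (int_mul hm r1 hv) ((r1.integrable hm).mul_const _), integral_mul_const, ro_int d hw]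
  have e5 : (Lambda1 m)⁻¹ * (Lambda1 m / 2) = 1/2 := by field_simp
  unfold FF
  rw [e4, e3]
  have h6 : (Lambda1 m)⁻¹ * (2 * ∫ x, gg K f Λ v x * WW (gg K f Λ w) x) ≤
      (Lambda1 m)⁻¹ * ((∫ x, gg K f Λ v x * WW (gg K f Λ v) x) + ∫ x, gg K f Λ w x * WW (gg K f Λ w) x) := by
    gcongr
  have h7 : (Lambda1 m)⁻¹ * (2 * ∫ x, gg K f Λ v x * WW (gg K f Λ w) x)
      = (∫ x, ro K Λ v x * v x) - ∫ x, f x * v x := by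
    rw [e1]; linear_combination (2 * ((∫ x, ro K Λ v x * v x) - ∫ x, f x * v x)) * e5
  have h8 : (Lambda1 m)⁻¹ * (2 * ∫ x, gg K f Λ w x * WW (gg K f Λ w) x)
      = (∫ x, ro K Λ w x * v x) - ∫ x, f x * v x := by
    rw [e2]; linear_combination (2 * ((∫ x, ro K Λ w x * v x) - ∫ x, f x * v x)) * e5
  rw [h7, mul_add] at h6
  linarith

lemma gibbs (d : Dat K f Λ CK Cf) (hw : BM B w) (u : Euc m → ℝ)
    (hi : Integrable (fun x => ro K Λ w x * u x)) (hK : Integrable (fun x => K x * Real.exp (u x))) :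
    ∫ x, ro K Λ w x * u x ≤ 2*m * SS K Λ w + ∫ x, K x * Real.exp (u x) := by
  have i1 := (int_mul d.hm (ro_cls d hw) (BM_add hw (cf K Λ w))).const_mul (2*m : ℝ)
  unfold SS
  rw [← integral_const_mul, ← integral_add i1 hK]
  refine integral_mono hi (i1.add hK) fun x => ?_
  simp only [Pi.add_apply]
  unfold ro
  set p := w x + cf K Λ w
  have h1 : Real.exp (u x) = Real.exp (2*m*p) * Real.exp (u x - 2*m*p) := by rw [← Real.exp_add]; congr 1; ring
  rw [h1]
  have h2 := Real.add_one_le_exp (u x - 2*m*p)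
  have h3 : 0 ≤ K x * Real.exp (2*m*p) := mul_nonneg (d.K0 x) (Real.exp_pos _).le
  nlinarith

lemma SS_lower (d : Dat K f Λ CK Cf) (hw : BM B w) : 0 ≤ 2*m * SS K Λ w + ∫ x, K x := by
  have := gibbs d hw (fun _ => 0) (by simp) (by simpa using d.hK.integrable d.hm)
  simpa using this

lemma pot_bd (d : Dat K f Λ CK Cf) {a : ℝ} (ha0 : 0 < a) (ha : a < 2*m) : ∃ M : ℝ, ∀ (B : ℝ) (w : Euc m → ℝ), BM B w →
    ∀ y, a * WW (ro K Λ w) y ≤ 2*m * SS K Λ w + M := by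
  obtain ⟨M, hM⟩ := exp_Nk_int d.hm ha0 ha
  refine ⟨CK * M, fun B w hw y => ?_⟩
  have h1 := (Nk_g_int d.hm (ro_cls d hw) y).const_mul a
  have hC := d.hK.nonneg
  have hb : ∀ x, K x * Real.exp (a * Nk x y) ≤ CK * (bw x * Real.exp (a * Nk x y)) := by
    intro x
    have h1 := (abs_of_nonneg (d.K0 x)) ▸ d.hK.bd x
    rw [← mul_assoc]; gcongr
  have h2 : Integrable (fun x => K x * Real.exp (a * Nk x y)) := by
    refine ((hM y).1.const_mul CK).mono' ?_ (Eventually.of_forall fun x => ?_)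
    · have h1 : Measurable (fun x => Nk x y) := Nk_m measurable_id measurable_const
      exact (d.hK.meas.mul (h1.const_mul a).exp).aestronglyMeasurable
    · rw [Real.norm_of_nonneg (mul_nonneg (d.K0 x) (Real.exp_pos _).le)]; exact hb x
  have h3 := gibbs d hw (fun x => a * Nk x y) (h1.congr (Eventually.of_forall fun x => by simp only; ring)) h2
  have h4 : ∫ x, K x * Real.exp (a * Nk x y) ≤ CK * M := by
    refine (integral_mono h2 ((hM y).1.const_mul CK) hb).trans ?_
    rw [integral_const_mul]
    have := (hM y).2
    gcongr
  have h5 : a * WW (ro K Λ w) y = ∫ x, ro K Λ w x * (a * Nk x y) := by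
    unfold WW; rw [← integral_const_mul]; congr 1; ext x; ring
  linarith

lemma WW_ro_nonneg (d : Dat K f Λ CK Cf) (w : Euc m → ℝ) (y : Euc m) : 0 ≤ WW (ro K Λ w) y :=
  integral_nonneg fun x => mul_nonneg (Nk_nonneg _ _) (ro_nonneg d w x)

/-- coercivity -/
lemma coerc (d : Dat K f Λ CK Cf) : ∃ θ E : ℝ, 0 < θ ∧ ∀ (B : ℝ) (w : Euc m → ℝ), BM B w →
    θ * SS K Λ w ≤ FF K f Λ w + E := by
  have hm := d.hm
  have hp := Lambda1_pos hm
  have hm' : (0:ℝ) < m := by exact_mod_cast hm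
  have hΛ := d.Λ0
  have hr : Λ / Lambda1 m < 1 := (div_lt_one hp).2 d.Λ1
  have hr0 : 0 < Λ / Lambda1 m := div_pos hΛ hp
  set r := Λ / Lambda1 m with hrd
  set a : ℝ := m * (1 + r) with had
  have ha0 : 0 < a := by positivity
  have ha : a < 2*m := by nlinarith
  obtain ⟨M, hM⟩ := pot_bd d ha0 ha
  obtain ⟨Q, hQ0, hQ⟩ := WW_bd hm
  set q := Cf * Q with hq
  have hfQ := hQ Cf f d.hf
  have hq0 : 0 ≤ q := (abs_nonneg _).trans (hfQ 0)
  refine ⟨1 - r * (2*m) / a, r * M / a + (Lambda1 m)⁻¹ * (2 * q * Λ + q * ∫ x, |f x|), ?_, fun B w hw => ?_⟩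
  · rw [sub_pos, div_lt_one ha0]; nlinarith
  have r1 := ro_cls d hw
  have g1 := gg_cls d hw
  obtain ⟨B1, b1⟩ := BM_WW hm r1
  obtain ⟨B2, b2⟩ := BM_WW hm d.hf
  have hWg : ∀ x, WW (gg K f Λ w) x = WW (ro K Λ w) x - WW f x := WW_sub hm r1 d.hf
  have ri := r1.integrable hm
  have fi := d.hf.integrable hm
  have i1 : Integrable (fun x => ro K Λ w x * WW (ro K Λ w) x - ro K Λ w x * WW f x) :=
    (int_mul hm r1 b1).sub (int_mul hm r1 b2)
  have i2 : Integrable (fun x => f x * WW (ro K Λ w) x - f x * WW f x) :=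
    (int_mul hm d.hf b1).sub (int_mul hm d.hf b2)
  have e1 : ∫ x, gg K f Λ w x * WW (gg K f Λ w) x = ((∫ x, ro K Λ w x * WW (ro K Λ w) x) - ∫ x, ro K Λ w x * WW f x)
      - ((∫ x, f x * WW (ro K Λ w) x) - ∫ x, f x * WW f x) := by
    rw [← integral_sub (int_mul hm r1 b1) (int_mul hm r1 b2), ← integral_sub (int_mul hm d.hf b1) (int_mul hm d.hf b2),
      ← integral_sub i1 i2]
    congr 1; ext x; rw [hWg]; unfold gg; ring
  have e2 : ∫ x, f x * WW (ro K Λ w) x = ∫ x, ro K Λ w x * WW f x := by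
    rw [← WW_symm hm d.hf r1]; congr 1; ext x; ring
  have b3 : -(q * Λ) ≤ ∫ x, ro K Λ w x * WW f x := by
    have : ∫ x, ro K Λ w x * (-q) ≤ ∫ x, ro K Λ w x * WW f x := by
      refine integral_mono (ri.mul_const _) (int_mul hm r1 b2) fun x => ?_
      have := ro_nonneg d w x
      simp only
      gcongr
      exact (abs_le.1 (hfQ x)).1
    rw [integral_mul_const, ro_int d hw] at this
    linarith
  have b4 : ∫ x, f x * WW f x ≤ q * ∫ x, |f x| := by
    rw [← integral_const_mul]
    refine integral_mono (int_mul hm d.hf b2) (fi.abs.const_mul q) fun x => ?_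
    simp only
    calc f x * WW f x ≤ |f x * WW f x| := le_abs_self _
      _ = |f x| * |WW f x| := abs_mul _ _
      _ ≤ |f x| * q := by gcongr; exact hfQ x
      _ = _ := by ring
  have b5 : ∫ x, ro K Λ w x * WW (ro K Λ w) x ≤ Λ * ((2*m * SS K Λ w + M) / a) := by
    have h0 : ∫ x, ro K Λ w x * WW (ro K Λ w) x ≤ ∫ x, ro K Λ w x * ((2*m * SS K Λ w + M) / a) := by
      refine integral_mono (int_mul hm r1 b1) (ri.mul_const _) fun x => ?_
      have := ro_nonneg d w x
      simp only
      gcongr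
      rw [le_div_iff₀ ha0, mul_comm]
      exact hM B w hw x
    rwa [integral_mul_const, ro_int d hw] at h0
  unfold FF
  rw [e1, e2]
  have b6 : (Lambda1 m)⁻¹ * ((∫ x, ro K Λ w x * WW (ro K Λ w) x) - (∫ x, ro K Λ w x * WW f x)
      - ((∫ x, ro K Λ w x * WW f x) - ∫ x, f x * WW f x))
      ≤ (Lambda1 m)⁻¹ * (Λ * ((2*m * SS K Λ w + M) / a) + (2 * q * Λ + q * ∫ x, |f x|)) := by
    gcongr; linarith
  have e3 : (Lambda1 m)⁻¹ * (Λ * ((2*m * SS K Λ w + M) / a)) = r * (2*m)/a * SS K Λ w + r * M / a := by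
    rw [hrd]; field_simp
  rw [mul_add, e3] at b6
  linarith

end

end

section

variable {m : ℕ}

lemma ascoli_seq (u : ℕ → Euc m → ℝ) (B L : ℝ) (hb : ∀ k x, |u k x| ≤ B)
    (hL : ∀ k x y, |u k x - u k y| ≤ L * ‖x - y‖) :
    ∃ (w : Euc m → ℝ) (φ : ℕ → ℕ), StrictMono φ ∧ ∀ x, Tendsto (fun k => u (φ k) x) atTop (𝓝 (w x)) := by
  have hL0 : 0 ≤ |L| := abs_nonneg L
  let q := TopologicalSpace.denseSeq (Euc m)
  have hq : DenseRange q := TopologicalSpace.denseRange_denseSeq _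
  have hc : IsCompact (Set.pi univ (fun _ : ℕ => Icc (-B) B)) := isCompact_univ_pi fun _ => isCompact_Icc
  obtain ⟨a, _, φ, hφ, hlim⟩ := hc.tendsto_subseq (x := fun k n => u k (q n))
    (fun k n _ => abs_le.1 (hb k (q n)))
  rw [tendsto_pi_nhds] at hlim
  have key : ∀ x, ∃ l, Tendsto (fun k => u (φ k) x) atTop (𝓝 l) := by
    intro x
    apply cauchySeq_tendsto_of_complete
    rw [Metric.cauchySeq_iff]
    intro ε hε
    have hd : 0 < ε / (4 * (|L| + 1)) := by positivity
    obtain ⟨n, hn⟩ := hq.exists_dist_lt x hd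
    have hcs := (hlim n).cauchySeq
    rw [Metric.cauchySeq_iff] at hcs
    obtain ⟨N, hN⟩ := hcs (ε/2) (by positivity)
    refine ⟨N, fun i hi j hj => ?_⟩
    have h1 := hN i hi j hj
    simp only [Function.comp, Real.dist_eq] at h1 ⊢
    have h2 : ∀ k, |u k x - u k (q n)| ≤ ε / 4 := by
      intro k
      refine (hL k x (q n)).trans ?_
      rw [dist_eq_norm] at hn
      have : L * ‖x - q n‖ ≤ (|L| + 1) * (ε / (4 * (|L| + 1))) := by
        have h3 : L ≤ |L| + 1 := by linarith [le_abs_self L]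
        gcongr
      refine this.trans (le_of_eq ?_)
      field_simp
    have h3 := h2 (φ i)
    have h4 := h2 (φ j)
    rw [abs_lt] at h1 ⊢
    rw [abs_le] at h3 h4
    constructor <;> linarith
  choose w hw using key
  exact ⟨w, φ, hφ, hw⟩

section
variable {K f w v : Euc m → ℝ} {Λ CK Cf B : ℝ}

lemma BM_lim {u : ℕ → Euc m → ℝ} (hu : ∀ j, BM B (u j)) (h : ∀ x, Tendsto (fun j => u j x) atTop (𝓝 (w x))) :
    BM B w :=
  ⟨measurable_of_tendsto_metrizable (fun j => (hu j).meas) (tendsto_pi_nhds.2 h), fun x =>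
    le_of_tendsto (h x).abs (Eventually.of_forall fun j => (hu j).bd x)⟩

lemma Zf_lim (d : Dat K f Λ CK Cf) {u : ℕ → Euc m → ℝ} (hu : ∀ j, BM B (u j))
    (h : ∀ x, Tendsto (fun j => u j x) atTop (𝓝 (w x))) : Tendsto (fun j => Zf K (u j)) atTop (𝓝 (Zf K w)) := by
  unfold Zf
  refine tendsto_integral_of_dominated_convergence (fun x => K x * Real.exp (2*m*B)) (fun j => (Zf_bd d (hu j)).1.1)
    ((d.hK.integrable d.hm).mul_const _) (fun j => Eventually.of_forall fun x => ?_) (Eventually.of_forall fun x => ?_)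
  · rw [Real.norm_of_nonneg (mul_nonneg (d.K0 x) (Real.exp_pos _).le)]
    have := (abs_le.1 ((hu j).bd x)).2
    have := d.K0 x
    gcongr
  · exact (((Real.continuous_exp.tendsto _).comp ((h x).const_mul _))).const_mul _

lemma cf_lim (d : Dat K f Λ CK Cf) {u : ℕ → Euc m → ℝ} (hu : ∀ j, BM B (u j))
    (h : ∀ x, Tendsto (fun j => u j x) atTop (𝓝 (w x))) : Tendsto (fun j => cf K Λ (u j)) atTop (𝓝 (cf K Λ w)) := by
  unfold cf
  have hz := Zf_pos d (BM_lim hu h)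
  have h1 := (tendsto_const_nhds (x := Λ)).div (Zf_lim d hu h) hz.ne'
  exact (h1.log (div_pos d.Λ0 hz).ne').const_mul _

lemma ro_lim (d : Dat K f Λ CK Cf) {u : ℕ → Euc m → ℝ} (hu : ∀ j, BM B (u j))
    (h : ∀ x, Tendsto (fun j => u j x) atTop (𝓝 (w x))) (x : Euc m) :
    Tendsto (fun j => ro K Λ (u j) x) atTop (𝓝 (ro K Λ w x)) := by
  unfold ro
  exact (((Real.continuous_exp.tendsto _).comp (((h x).add (cf_lim d hu h)).const_mul _))).const_mul _

lemma TT_lim (d : Dat K f Λ CK Cf) {u : ℕ → Euc m → ℝ} (hu : ∀ j, BM B (u j))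
    (h : ∀ x, Tendsto (fun j => u j x) atTop (𝓝 (w x))) (y : Euc m) :
    Tendsto (fun j => TT K f Λ (u j) y) atTop (𝓝 (TT K f Λ w y)) := by
  unfold TT
  refine Tendsto.div_const ?_ _
  unfold WW
  obtain ⟨M, hM⟩ := bwNk d.hm
  refine tendsto_integral_of_dominated_convergence (fun x => (DD K Λ CK B + Cf) * (Nk x y * bw x))
    (fun j => (Nk_g_int d.hm (gg_cls d (hu j)) y).1)
    ((hM y).1.const_mul _) (fun j => Eventually.of_forall fun x => ?_) (Eventually.of_forall fun x => ?_)
  · rw [norm_mul, Real.norm_of_nonneg (Nk_nonneg x y), Real.norm_eq_abs]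
    have := (gg_cls d (hu j)).bd x
    calc _ ≤ Nk x y * ((DD K Λ CK B + Cf) * bw x) := mul_le_mul_of_nonneg_left this (Nk_nonneg x y)
      _ = _ := by ring
  · unfold gg
    exact ((ro_lim d hu h x).sub_const _).const_mul _

lemma RR_split (d : Dat K f Λ CK Cf) {B' : ℝ} (hw : BM B w) (hv : BM B' v) :
    RR K Λ w v = (∫ x, ro K Λ w x * (w x - v x)) + Λ * (cf K Λ w - cf K Λ v) := by
  have r1 := ro_cls d hw
  have i1 : Integrable (fun x => ro K Λ w x * (w x - v x)) := by
    simp_rw [mul_sub]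
    exact (int_mul d.hm r1 hw).sub (int_mul d.hm r1 hv)
  rw [← ro_int d hw, ← integral_mul_const, ro_int d hw, ← integral_add i1 ((r1.integrable d.hm).mul_const _)]
  unfold RR
  congr 1; ext x; ring

lemma RR_lim (d : Dat K f Λ CK Cf) {u z : ℕ → Euc m → ℝ} (hu : ∀ j, BM B (u j)) (hz : ∀ j, BM B (z j))
    (h : ∀ x, Tendsto (fun j => u j x) atTop (𝓝 (w x))) (h' : ∀ x, Tendsto (fun j => z j x) atTop (𝓝 (v x))) :
    Tendsto (fun j => RR K Λ (u j) (z j)) atTop (𝓝 (RR K Λ w v)) := by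
  rw [RR_split d (BM_lim hu h) (BM_lim hz h')]
  simp_rw [fun j => RR_split d (hu j) (hz j)]
  refine Tendsto.add ?_ (((cf_lim d hu h).sub (cf_lim d hz h')).const_mul _)
  refine tendsto_integral_of_dominated_convergence (fun x => (DD K Λ CK B) * bw x * (2*B))
    (fun j => ?_) (((bw_int d.hm).const_mul _).mul_const _) (fun j => Eventually.of_forall fun x => ?_)
    (Eventually.of_forall fun x => ?_)
  · exact ((ro_cls d (hu j)).meas.mul ((hu j).meas.sub (hz j).meas)).aestronglyMeasurable
  · rw [norm_mul, Real.norm_eq_abs, Real.norm_eq_abs]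
    have h1 := (ro_cls d (hu j)).bd x
    have h2 : |u j x - z j x| ≤ 2 * B := (abs_sub _ _).trans (by linarith [(hu j).bd x, (hz j).bd x])
    exact mul_le_mul h1 h2 (abs_nonneg _) ((abs_nonneg _).trans h1)
  · exact (ro_lim d hu h x).mul ((h x).sub (h' x))

/-- vanishing relative entropy -/
lemma RR_zero (d : Dat K f Λ CK Cf) {B' : ℝ} (hw : BM B w) (hv : BM B' v) (h0 : RR K Λ w v = 0) :
    ro K Λ w =ᵐ[volume] ro K Λ v := by
  have hm' : (0:ℝ) < 2*m := by have := d.hm; positivity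
  have i0 : Integrable (fun x => ro K Λ w x - ro K Λ v x) :=
    ((ro_cls d hw).integrable d.hm).sub ((ro_cls d hv).integrable d.hm)
  have i1 := (RR_i d hw hv).const_mul (2*m : ℝ)
  have i2 : ∫ x, (2*m * (ro K Λ w x * ((w x + cf K Λ w) - (v x + cf K Λ v))) - (ro K Λ w x - ro K Λ v x)) = 0 := by
    rw [integral_sub i1 i0, integral_const_mul, integral_sub ((ro_cls d hw).integrable d.hm)
      ((ro_cls d hv).integrable d.hm), ro_int d hw, ro_int d hv]
    unfold RR at h0
    rw [h0]; ring
  rw [integral_eq_zero_iff_of_nonneg (fun x => sub_nonneg.2 (RR_pt d w v x)) (i1.sub i0)] at i2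
  filter_upwards [i2] with x hx
  simp only [Pi.zero_apply] at hx
  unfold ro at hx ⊢
  set p := w x + cf K Λ w
  set q := v x + cf K Λ v
  by_cases hK : K x = 0
  · rw [hK]; ring
  have hk : 0 < K x * Real.exp (2*m*p) := mul_pos (lt_of_le_of_ne (d.K0 x) (Ne.symm hK)) (Real.exp_pos _)
  have h1 : Real.exp (2*m*q) = Real.exp (2*m*p) * Real.exp (2*m*q - 2*m*p) := by rw [← Real.exp_add]; congr 1; ring
  by_contra hne
  have hpq : 2*m*q - 2*m*p ≠ 0 := by
    intro h; apply hne
    rw [h1, h]; simp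
  have h2 := Real.add_one_lt_exp hpq
  rw [h1] at hx
  nlinarith

lemma Cls_zero_BM : BM (m := m) 0 (fun _ => 0) := ⟨measurable_const, fun x => by simp⟩

lemma fixpt (d : Dat K f Λ CK Cf) : ∃ (B : ℝ) (w : Euc m → ℝ), BM B w ∧ TT K f Λ w = w := by
  have hm := d.hm
  have hp := Lambda1_pos hm
  have hm1 : (1:ℝ) ≤ m := by exact_mod_cast hm
  set u : ℕ → Euc m → ℝ := fun k => (TT K f Λ)^[k] (fun _ => 0) with hu
  have us : ∀ k, u (k+1) = TT K f Λ (u k) := fun k => Function.iterate_succ_apply' _ _ _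
  have hB0 : ∀ k, ∃ B, BM B (u k) := by
    intro k
    induction k with
    | zero => exact ⟨0, Cls_zero_BM⟩
    | succ k ih => obtain ⟨B, hB⟩ := ih; rw [us]; exact TT_BM d hB
  choose B0 hB0 using hB0
  have hstep : ∀ k, 0 ≤ RR K Λ (u k) (u (k+1)) ∧ RR K Λ (u k) (u (k+1)) ≤ FF K f Λ (u k) - FF K f Λ (u (k+1)) := by
    intro k
    refine ⟨RR_nonneg d (hB0 k) (hB0 (k+1)), ?_⟩
    rw [us]; exact FF_mono d (hB0 k)
  have hanti : Antitone (fun k => FF K f Λ (u k)) := antitone_nat_of_succ_le fun k => by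
    have := hstep k; linarith
  obtain ⟨θ, E, hθ, hco⟩ := coerc d
  have hS : ∀ k, SS K Λ (u k) ≤ (FF K f Λ (u 0) + E) / θ := by
    intro k
    rw [le_div_iff₀ hθ]
    have h1 := hco _ _ (hB0 k)
    have h2 := hanti (Nat.zero_le k)
    simp only at h2
    linarith
  obtain ⟨M, hM⟩ := pot_bd d (a := 1) one_pos (by linarith)
  obtain ⟨Q, hQ0, hQ⟩ := WW_bd hm
  have hfQ := hQ Cf f d.hf
  set P := 2*m*((FF K f Λ (u 0) + E) / θ) + M with hPd
  have hPb : ∀ k y, WW (ro K Λ (u k)) y ≤ P := by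
    intro k y
    have h1 := hM _ _ (hB0 k) y
    have h2 : 2*m * SS K Λ (u k) ≤ 2*m*((FF K f Λ (u 0) + E) / θ) := by
      have := hS k
      gcongr
    linarith
  have hP0 : 0 ≤ P := (WW_ro_nonneg d (u 0) 0).trans (hPb 0 0)
  have hq0 : 0 ≤ Cf * Q := (abs_nonneg _).trans (hfQ 0)
  set B := (P + Cf * Q) / (Lambda1 m / 2) with hBd
  have hBB : ∀ k, BM B (u k) := by
    intro k
    refine ⟨(hB0 k).meas, fun x => ?_⟩
    cases k with
    | zero => simp only [hu, Function.iterate_zero, id, abs_zero]; positivity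
    | succ k =>
      rw [us]
      unfold TT
      rw [abs_div, abs_of_pos (show 0 < Lambda1 m / 2 by linarith), hBd]
      gcongr
      have h1 : WW (gg K f Λ (u k)) x = WW (ro K Λ (u k)) x - WW f x := WW_sub hm (ro_cls d (hB0 k)) d.hf x
      rw [h1]
      refine (abs_sub _ _).trans (add_le_add ?_ (hfQ x))
      rw [abs_of_nonneg (WW_ro_nonneg d _ _)]
      exact hPb k x
  obtain ⟨A, hA0, hA⟩ := VV_lip hm
  have hD0 : 0 ≤ DD K Λ CK B + Cf := (gg_cls d (hBB 0)).nonneg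
  have hLip : ∀ k x y, |u k x - u k y| ≤ (DD K Λ CK B + Cf) * A / (Lambda1 m / 2) * ‖x - y‖ := by
    intro k x y
    cases k with
    | zero => simp only [hu, Function.iterate_zero, id, sub_self, abs_zero]; positivity
    | succ k =>
      rw [us]
      unfold TT
      rw [← sub_div, abs_div, abs_of_pos (show 0 < Lambda1 m / 2 by linarith), div_mul_eq_mul_div]
      gcongr
      have c := gg_cls d (hBB k)
      have c0 := gg_int d (hBB k)
      rw [link hm c c0 x, link hm c c0 y, add_sub_add_right_eq_sub]
      exact hA _ _ c c0 x y
  obtain ⟨w, φ, hφ, hlim⟩ := ascoli_seq u B _ (fun k x => (hBB k).bd x) hLip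
  have hlim2 : ∀ x, Tendsto (fun j => u (φ j + 1) x) atTop (𝓝 (TT K f Λ w x)) := by
    intro x
    simp_rw [us]
    exact TT_lim d (fun j => hBB (φ j)) hlim x
  have hw := BM_lim (fun j => hBB (φ j)) hlim
  have hv := BM_lim (fun j => hBB (φ j + 1)) hlim2
  have hR := RR_lim d (fun j => hBB (φ j)) (fun j => hBB (φ j + 1)) hlim hlim2
  have hbdd : BddBelow (range fun k => FF K f Λ (u k)) := by
    refine ⟨θ * (-(∫ x, K x) / (2*m)) - E, ?_⟩
    rintro _ ⟨k, rfl⟩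
    have h1 := hco _ _ (hBB k)
    have h2 := SS_lower d (hBB k)
    have h3 : -(∫ x, K x) / (2*m) ≤ SS K Λ (u k) := by
      rw [div_le_iff₀ (by positivity)]; linarith
    have h4 : θ * (-(∫ x, K x) / (2*m)) ≤ θ * SS K Λ (u k) := by gcongr
    simp only
    linarith
  have hF := tendsto_atTop_ciInf hanti hbdd
  have hF2 := hF.sub (hF.comp (tendsto_add_atTop_nat 1))
  rw [sub_self] at hF2
  have hR0 : Tendsto (fun k => RR K Λ (u k) (u (k+1))) atTop (𝓝 0) :=
    squeeze_zero (fun k => (hstep k).1) (fun k => (hstep k).2) hF2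
  have hz : RR K Λ w (TT K f Λ w) = 0 := tendsto_nhds_unique hR (hR0.comp hφ.tendsto_atTop)
  have hae := RR_zero d hw hv hz
  refine ⟨B, TT K f Λ w, hv, ?_⟩
  ext y
  have : WW (gg K f Λ (TT K f Λ w)) y = WW (gg K f Λ w) y := by
    unfold WW
    refine integral_congr_ae ?_
    filter_upwards [hae] with x hx
    unfold gg
    rw [hx]
  conv_lhs => unfold TT
  conv_rhs => unfold TT
  exact congrArg (· / (Lambda1 m / 2)) this

lemma solve (d : Dat K f Λ CK Cf) : ∃ (w : Euc m → ℝ) (c : ℝ),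
      ContDiff ℝ (2*m - 1 : ℕ) w ∧
      (∀ ψ : Euc m → ℝ, ContDiff ℝ (⊤ : ℕ∞) ψ → HasCompactSupport ψ →
        ∫ x, w x * negLapPow m ψ x
          = ∫ x, (K x * Real.exp ((2*m : ℝ) * (w x + c)) - f x) * ψ x) ∧
      Integrable (fun x => K x * Real.exp ((2*m : ℝ) * (w x + c))) ∧
      (∫ x, K x * Real.exp ((2*m : ℝ) * (w x + c))) = Λ ∧
      ∃ L : ℝ, Tendsto w (cocompact (Euc m)) (𝓝 L) := by
  obtain ⟨B, w, hw, hfix⟩ := fixpt d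
  have hm := d.hm
  have hp := Lambda1_pos hm
  have c := gg_cls d hw
  have c0 := gg_int d hw
  set a := ∫ y, Real.log (1 + ‖y‖) * gg K f Λ w y with had
  have hwe : w = fun x => (VV (gg K f Λ w) x + a) / (Lambda1 m / 2) := by
    ext x
    rw [← link hm c c0 x]
    exact (congrFun hfix x).symm
  refine ⟨w, cf K Λ w, ?_, ?_, (ro_cls d hw).integrable hm, ro_int d hw, a / (Lambda1 m / 2), ?_⟩
  · rw [hwe]
    exact ((VV_contDiff hm c c0).add contDiff_const).div_const _
  · intro ψ h1 h2
    have h3 := WW_dist hm c c0 (⟨h1, h2⟩ : Tst ψ)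
    have h4 : ∀ x, w x * negLapPow m ψ x = (Lambda1 m / 2)⁻¹ * (WW (gg K f Λ w) x * negLapPow m ψ x) := by
      intro x
      conv_lhs => rw [← hfix]
      unfold TT
      ring
    simp_rw [h4]
    rw [integral_const_mul, h3, ← mul_assoc, inv_mul_cancel₀ (by positivity), one_mul]
    rfl
  · rw [hwe]
    have h5 := ((VV_lim hm c c0).add_const a).div_const (Lambda1 m / 2)
    rwa [zero_add] at h5

lemma w0_bd (x : Euc m) : Real.exp (2*m * Real.log (2 / (1 + ‖x‖^2))) ≤ (4:ℝ)^(2*m:ℝ) * bw x := by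
  have h0 := norm_nonneg x
  unfold bw
  rw [mul_comm, ← Real.rpow_def_of_pos (by positivity)]
  have e : (1 + ‖x‖) ^ (-(4 * m : ℝ)) = (((1 + ‖x‖)^2)⁻¹) ^ (2*m:ℝ) := by
    rw [Real.inv_rpow (by positivity), ← Real.rpow_natCast, ← Real.rpow_mul (by positivity), ← Real.rpow_neg (by positivity)]
    congr 1; push_cast; ring
  rw [e, ← Real.mul_rpow (by norm_num) (by positivity)]
  refine Real.rpow_le_rpow (by positivity) ?_ (by positivity)
  rw [div_le_iff₀ (by positivity), ← div_eq_mul_inv, div_mul_eq_mul_div, le_div_iff₀ (by positivity)]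
  nlinarith [sq_nonneg (1 - ‖x‖)]

lemma Cls_of {g : Euc m → ℝ} {w₀ : Euc m → ℝ} (hw₀ : ∀ x : Euc m, w₀ x = Real.log (2 / (1 + ‖x‖^2)))
    (hg : Measurable g) {C : ℝ} (h : ∀ x, |g x| * Real.exp (-(2*m : ℝ) * w₀ x) ≤ C) :
    Cls (C * (4:ℝ)^(2*m:ℝ)) g := by
  have hC : 0 ≤ C := le_trans (by positivity) (h 0)
  refine ⟨hg, fun x => ?_⟩
  have h1 := h x
  rw [neg_mul, Real.exp_neg, ← div_eq_mul_inv, div_le_iff₀ (Real.exp_pos _), hw₀] at h1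
  refine h1.trans ?_
  rw [mul_assoc C]
  exact mul_le_mul_of_nonneg_left (w0_bd x) hC

end

end

/-- **Proposition (existence for the perturbed Liouville equation on `ℝ^{2m}`).**
With `w₀(x) = log(2/(1+|x|²))`, `K ≥ 0` measurable not a.e. zero with `K e^{−2m w₀}`
bounded, `f` measurable with `f e^{−2m w₀}` bounded and `Λ = ∫ f ∈ (0, Λ₁)`, there are
`w ∈ C^{2m−1}(ℝ^{2m})` and `c_w ∈ ℝ` with `(−Δ)^m w = K e^{2m(w+c_w)} − f`
distributionally, `∫ K e^{2m(w+c_w)} = Λ`, and `w` converging to a finite limit at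
infinity. -/
theorem statement7 (m : ℕ) (hm : 1 ≤ m)
    (w₀ : Euc m → ℝ) (hw₀ : ∀ x : Euc m, w₀ x = Real.log (2 / (1 + ‖x‖^2)))
    (K f : Euc m → ℝ) (hKmeas : Measurable K) (hfmeas : Measurable f)
    (hKpos : ∀ x, 0 ≤ K x) (hKne : ¬ (K =ᵐ[volume] 0))
    (hKbd : ∃ C : ℝ, ∀ x, K x * Real.exp (-(2*m : ℝ) * w₀ x) ≤ C)
    (hfbd : ∃ C : ℝ, ∀ x, |f x| * Real.exp (-(2*m : ℝ) * w₀ x) ≤ C)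
    (hfint : Integrable f)
    (Λ : ℝ) (hΛdef : Λ = ∫ x, f x) (hΛpos : 0 < Λ) (hΛlt : Λ < Lambda1 m) :
    ∃ (w : Euc m → ℝ) (c : ℝ),
      ContDiff ℝ (2*m - 1 : ℕ) w ∧
      (∀ ψ : Euc m → ℝ, ContDiff ℝ (⊤ : ℕ∞) ψ → HasCompactSupport ψ →
        ∫ x, w x * negLapPow m ψ x
          = ∫ x, (K x * Real.exp ((2*m : ℝ) * (w x + c)) - f x) * ψ x) ∧
      Integrable (fun x => K x * Real.exp ((2*m : ℝ) * (w x + c))) ∧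
      (∫ x, K x * Real.exp ((2*m : ℝ) * (w x + c))) = Λ ∧
      ∃ L : ℝ, Tendsto w (cocompact (Euc m)) (𝓝 L) := by
  obtain ⟨CK, hCK⟩ := hKbd
  obtain ⟨Cf, hCf⟩ := hfbd
  have cK : Cls (CK * (4:ℝ)^(2*m:ℝ)) K := Cls_of hw₀ hKmeas fun x => by
    rw [abs_of_nonneg (hKpos x)]; exact hCK x
  have cF : Cls (Cf * (4:ℝ)^(2*m:ℝ)) f := Cls_of hw₀ hfmeas hCf
  have kp : 0 < ∫ x, K x := by
    refine lt_of_le_of_ne (integral_nonneg hKpos) fun h => hKne ?_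
    exact (integral_eq_zero_iff_of_nonneg hKpos (cK.integrable hm)).1 h.symm
  exact solve (⟨hm, cK, hKpos, kp, cF, hΛdef.symm, hΛpos, hΛlt⟩ : Dat K f Λ _ _)
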